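/- arXiv:2506.06197 — 12 statements merged into one kernel-verified Lean document; each statement's English description precedes it below -/
import Mathlib

section
/- Let ρ_1, …, ρ_n be density matrices on ℂ^d (positive semidefinite complex d×d matrices with trace 1) prepared with uniform prior 1/n, and let λ be a real number such that ρ_x ≤ λ·I for every x (in the Loewner order). Then for every POVM (M(x))_{x=1}^n (positive semidefinite matrices with ∑_x M(x) = I), the success probability satisfies (1/n) ∑_{x=1}^n tr(ρ_x M(x)) ≤ (d/n)·λ. -/
open Matrix
open scoped ComplexOrder

open scoped MatrixOrder Matrix.Norms.L2Operator in
/-- The trace of a product of two positive semidefinite matrices is nonnegative. -/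
theorem Matrix.PosSemidef.trace_mul_nonneg {m : Type*} [Fintype m] {A B : Matrix m m ℂ}
    (hA : A.PosSemidef) (hB : B.PosSemidef) : 0 ≤ (A * B).trace := by
  classical
  obtain ⟨C, rfl⟩ := CStarAlgebra.nonneg_iff_eq_star_mul_self.mp hB.nonneg
  rw [star_eq_conjTranspose, ← Matrix.mul_assoc, Matrix.trace_mul_comm, ← Matrix.mul_assoc]
  exact (hA.mul_mul_conjTranspose_same C).trace_nonneg

/-- Upper bound part of Proposition 1: for density matrices `ρ x` on `ℂ^d`
with uniform prior `1/n` and `ρ x ≤ λ • 1` in the Loewner order, every POVM `M` has success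
probability at most `(d/n) * λ`. -/
theorem success_prob_le_of_loewner_bound
    (d n : ℕ) (ρ M : Fin n → Matrix (Fin d) (Fin d) ℂ)
    (hρpsd : ∀ x, (ρ x).PosSemidef) (hρtr : ∀ x, (ρ x).trace = 1)
    (lam : ℝ)
    (hlam : ∀ x, ((lam : ℂ) • (1 : Matrix (Fin d) (Fin d) ℂ) - ρ x).PosSemidef)
    (hMpsd : ∀ x, (M x).PosSemidef) (hMsum : ∑ x, M x = 1) :
    (1 / n : ℝ) * ∑ x, ((ρ x * M x).trace).re ≤ (d / n : ℝ) * lam := by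
  have hle : ∀ x, ((ρ x * M x).trace).re ≤ lam * ((M x).trace).re := fun x ↦ by
    have h := (Complex.nonneg_iff.mp ((hlam x).trace_mul_nonneg (hMpsd x))).1
    simpa [Matrix.sub_mul, Matrix.trace_sub, Matrix.trace_smul] using h
  have htr : ∑ x, ((M x).trace).re = d := by
    rw [← Complex.re_sum, ← Matrix.trace_sum, hMsum]
    simp
  calc (1 / n : ℝ) * ∑ x, ((ρ x * M x).trace).re
      ≤ (1 / n : ℝ) * ∑ x, lam * ((M x).trace).re := by
        gcongr with x
        exact hle x
    _ = (d / n : ℝ) * lam := by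
        rw [← Finset.mul_sum, htr]
        ring
end

section
/- Let (ρ_x)_{x∈X} be a finite family of n qubit states (2×2 positive semidefinite complex matrices with trace 1) prepared with uniform prior 1/n, and suppose there is a fixed-point-free involution x ↦ x' on X such that ρ_{x'} = I − ρ_x for every x (i.e., each state is paired with exactly one state having the opposite Bloch vector of equal length). Let λ = max_x ‖ρ_x‖ be the largest eigenvalue occurring among the states. Then the optimal success probability of discriminating these states equals (2/n)·λ; that is, the supremum over all POVMs (M(x))_{x∈X} of (1/n) ∑_{x∈X} tr(ρ_x M(x)) equals (2/n)·λ, and this supremum is attained. -/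
open Matrix
open scoped ComplexOrder

namespace Matrix

variable {n 𝕜 : Type*} [Fintype n] [DecidableEq n] [RCLike 𝕜]

open scoped MatrixOrder in
theorem PosSemidef.re_trace_mul_nonneg {A B : Matrix n n 𝕜} (hA : A.PosSemidef)
    (hB : B.PosSemidef) : 0 ≤ RCLike.re (A * B).trace := by
  obtain ⟨C, rfl⟩ := CStarAlgebra.nonneg_iff_eq_star_mul_self.mp hB.nonneg
  rw [star_eq_conjTranspose, ← Matrix.mul_assoc, trace_mul_cycle]
  exact (RCLike.nonneg_iff.mp (hA.mul_mul_conjTranspose_same C).trace_nonneg).1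

theorem IsHermitian.posSemidef_smul_one_sub {A : Matrix n n 𝕜} (hA : A.IsHermitian) {r : ℝ}
    (h : ∀ i, hA.eigenvalues i ≤ r) : ((r : 𝕜) • (1 : Matrix n n 𝕜) - A).PosSemidef := by
  have key : (r : 𝕜) • (1 : Matrix n n 𝕜) - A =
      (hA.eigenvectorUnitary : Matrix n n 𝕜) *
        diagonal (fun i => ((r - hA.eigenvalues i : ℝ) : 𝕜)) *
        (hA.eigenvectorUnitary : Matrix n n 𝕜)ᴴ := by
    have hd : diagonal (fun i => ((r - hA.eigenvalues i : ℝ) : 𝕜)) =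
        (r : 𝕜) • (1 : Matrix n n 𝕜) - diagonal (RCLike.ofReal ∘ hA.eigenvalues) := by
      ext i j
      by_cases hij : i = j <;> simp [hij, Algebra.algebraMap_eq_smul_one, sub_smul]
    conv_lhs => rw [hA.spectral_theorem]
    rw [hd, Matrix.mul_sub, Matrix.sub_mul]
    simp [Unitary.conjStarAlgAut_apply, ← star_eq_conjTranspose]
  rw [key]
  refine PosSemidef.mul_mul_conjTranspose_same (posSemidef_diagonal_iff.mpr fun i => ?_) _
  simpa using h i

/-- The trace of `A * M` is at most `r` times the trace of `M`, for `M` positive semidefinite and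
`r` an upper bound of the eigenvalues of `A`. -/
theorem IsHermitian.re_trace_mul_le {A M : Matrix n n 𝕜} (hA : A.IsHermitian)
    (hM : M.PosSemidef) {r : ℝ} (h : ∀ i, hA.eigenvalues i ≤ r) :
    RCLike.re (A * M).trace ≤ r * RCLike.re M.trace := by
  have := (hA.posSemidef_smul_one_sub h).re_trace_mul_nonneg hM
  simp only [Matrix.sub_mul, smul_mul, Matrix.one_mul, trace_sub, trace_smul, smul_eq_mul,
    map_sub, RCLike.re_ofReal_mul] at this
  linarith

theorem posSemidef_one_sub_vecMulVec {v : n → 𝕜} (hv : v ⬝ᵥ star v = 1) :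
    (1 - vecMulVec v (star v)).PosSemidef := by
  have h : 1 - vecMulVec v (star v) =
      (1 - vecMulVec v (star v))ᴴ * (1 - vecMulVec v (star v)) := by
    rw [conjTranspose_sub, conjTranspose_one, conjTranspose_vecMulVec, star_star,
      Matrix.mul_sub, Matrix.sub_mul, Matrix.sub_mul, vecMulVec_mul_vecMulVec, dotProduct_comm, hv]
    simp
  rw [h]
  exact posSemidef_conjTranspose_mul_self _

end Matrix

/-- Proposition 2 of the paper (value of the optimum): for a finite family of
qubit states with uniform prior, paired by a fixed-point-free involution `c` into pairs of states
with opposite Bloch vectors of equal length (`ρ (c x) = 1 - ρ x`), the optimal success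
probability of discrimination equals `(2/n) * λ`, where `λ` is the largest eigenvalue occurring
among the states; moreover the optimum is attained. -/
theorem qubit_symmetric_discrimination_value
    (X : Type) [Fintype X] [Nonempty X]
    (ρ : X → Matrix (Fin 2) (Fin 2) ℂ)
    (hpsd : ∀ x, (ρ x).PosSemidef) (htr : ∀ x, (ρ x).trace = 1)
    (c : X → X) (hinv : ∀ x, c (c x) = x) (hfpf : ∀ x, c x ≠ x)
    (hopp : ∀ x, ρ (c x) = 1 - ρ x)
    (lam : ℝ)
    (hlam : IsGreatest {r : ℝ | ∃ x i, r = (hpsd x).1.eigenvalues i} lam) :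
    IsGreatest {P : ℝ | ∃ M : X → Matrix (Fin 2) (Fin 2) ℂ,
        (∀ x, (M x).PosSemidef) ∧ (∑ x, M x = 1) ∧
        P = (1 / (Fintype.card X) : ℝ) * ∑ x, ((ρ x * M x).trace).re}
      ((2 / (Fintype.card X) : ℝ) * lam) := by
  classical
  constructor
  · obtain ⟨⟨x₀, i, rfl⟩, -⟩ := hlam
    set r := (hpsd x₀).1.eigenvalues i with hr
    set v : Fin 2 → ℂ := ⇑((hpsd x₀).1.eigenvectorBasis i) with hv_def
    have hv : v ⬝ᵥ star v = 1 := by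
      rw [hv_def, ← EuclideanSpace.inner_eq_star_dotProduct, inner_self_eq_norm_sq_to_K,
        (hpsd x₀).1.eigenvectorBasis.orthonormal.1 i]
      simp
    have hmul : ρ x₀ *ᵥ v = r • v := (hpsd x₀).1.mulVec_eigenvectorBasis i
    set Q := vecMulVec v (star v) with hQ
    have hρQ : (ρ x₀ * Q).trace = r := by
      rw [hQ, mul_vecMulVec, hmul, trace_vecMulVec, smul_dotProduct, hv]
      simp
    have hQtr : Q.trace = 1 := by rw [hQ, trace_vecMulVec, hv]
    have hρQ' : (ρ (c x₀) * (1 - Q)).trace = r := by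
      rw [hopp, Matrix.mul_sub, Matrix.mul_one, Matrix.sub_mul, Matrix.one_mul, trace_sub,
        trace_sub, trace_sub, hρQ, htr, hQtr, trace_one]
      simp
      ring
    have hne : c x₀ ≠ x₀ := hfpf x₀
    refine ⟨fun x => if x = x₀ then Q else if x = c x₀ then 1 - Q else 0, fun x => ?_, ?_, ?_⟩
    · dsimp only
      split_ifs
      · exact posSemidef_vecMulVec_self_star v
      · exact posSemidef_one_sub_vecMulVec hv
      · exact PosSemidef.zero
    · rw [Fintype.sum_eq_add x₀ (c x₀) hne.symm fun x hx => by simp [hx.1, hx.2]]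
      simp [hne]
    · rw [Fintype.sum_eq_add x₀ (c x₀) hne.symm fun x hx => by simp [hx.1, hx.2]]
      simp only [if_true, if_neg hne, hρQ, hρQ', Complex.ofReal_re]
      ring
  · rintro _ ⟨M, hM, hsum, rfl⟩
    have hle : ∑ x, ((ρ x * M x).trace).re ≤ ∑ x, lam * ((M x).trace).re :=
      Finset.sum_le_sum fun x _ => (hpsd x).1.re_trace_mul_le (hM x) fun i => hlam.2 ⟨x, i, rfl⟩
    have htot : ∑ x, lam * ((M x).trace).re = 2 * lam := by
      rw [← Finset.mul_sum, ← Complex.re_sum, ← trace_sum, hsum, trace_one]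
      simp [mul_comm]
    calc (1 / (Fintype.card X) : ℝ) * ∑ x, ((ρ x * M x).trace).re
        ≤ (1 / (Fintype.card X) : ℝ) * (2 * lam) := by
          gcongr
          exact hle.trans_eq htot
      _ = (2 / (Fintype.card X) : ℝ) * lam := by ring
end

section
/- Let (ρ_x)_{x∈X} be a finite family of n qubit states prepared with uniform prior 1/n, with a fixed-point-free involution x ↦ x' on X such that ρ_{x'} = I − ρ_x for every x, and let λ = max_x ‖ρ_x‖ with λ > 1/2. Then a POVM (M(x))_{x∈X} achieves the optimal success probability (2/n)·λ if and only if M(x) = 0 for every x with ‖ρ_x‖ < λ and, for every x with ‖ρ_x‖ = λ, M(x) is a nonnegative scalar multiple of the rank-one eigenprojection Λ_x of ρ_x associated with the eigenvalue λ (equivalently, M(x)·ρ_x = λ·M(x) for all x). -/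
open Matrix
open scoped ComplexOrder

section LoewnerOrder

open scoped MatrixOrder

/-- The eigenvalues of a Hermitian matrix bound it from above in the Loewner order. -/
theorem Matrix.IsHermitian.posSemidef_smul_one_sub_s4 {n : Type*} [Fintype n] [DecidableEq n]
    {A : Matrix n n ℂ} (hA : A.IsHermitian) {r : ℝ} (h : ∀ i, hA.eigenvalues i ≤ r) :
    ((r : ℂ) • (1 : Matrix n n ℂ) - A).PosSemidef := by
  have hle : A ≤ algebraMap ℝ (Matrix n n ℂ) r := by
    refine le_algebraMap_of_spectrum_le (fun x hx => ?_) hA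
    obtain ⟨i, rfl⟩ := hA.spectrum_real_eq_range_eigenvalues ▸ hx
    exact h i
  rw [Algebra.algebraMap_eq_smul_one] at hle
  simpa using Matrix.le_iff.mp hle

/-- The trace of a product of two positive semidefinite matrices is nonnegative, and vanishes
only if the product does. -/
theorem Matrix.PosSemidef.trace_mul_nonneg_and_eq_zero_iff {n : Type*} [Fintype n]
    [DecidableEq n] {A B : Matrix n n ℂ} (hA : A.PosSemidef) (hB : B.PosSemidef) :
    0 ≤ (A * B).trace ∧ ((A * B).trace = 0 ↔ A * B = 0) := by
  obtain ⟨C, rfl⟩ := CStarAlgebra.nonneg_iff_eq_star_mul_self.mp hA.nonneg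
  obtain ⟨D, rfl⟩ := CStarAlgebra.nonneg_iff_eq_star_mul_self.mp hB.nonneg
  simp only [star_eq_conjTranspose]
  have key : (Cᴴ * C * (Dᴴ * D)).trace = ((C * Dᴴ)ᴴ * (C * Dᴴ)).trace := by
    rw [conjTranspose_mul, conjTranspose_conjTranspose, ← mul_assoc, trace_mul_comm]
    simp only [mul_assoc]
  refine ⟨key ▸ (posSemidef_conjTranspose_mul_self _).trace_nonneg, fun h => ?_, fun h => ?_⟩
  · have hCD := trace_conjTranspose_mul_self_eq_zero_iff.mp (key ▸ h)
    rw [mul_assoc, ← mul_assoc C, hCD, zero_mul, mul_zero]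
  · rw [h, trace_zero]

end LoewnerOrder

/-- Characterization of the optimal measurements in Proposition 2: for a finite
family of qubit states with uniform prior, paired by a fixed-point-free involution `c` with
`ρ (c x) = 1 - ρ x`, and `λ > 1/2` the largest eigenvalue occurring among the states, a POVM `M`
achieves the optimal success probability `(2/n) * λ` if and only if `M x * ρ x = λ • M x` for
every `x` (equivalently: `M x = 0` whenever `ρ x` does not attain the eigenvalue `λ`, and `M x`
is a nonnegative multiple of the rank-one eigenprojection of `ρ x` for `λ` otherwise). -/
theorem qubit_symmetric_discrimination_optimal_iff
    (X : Type) [Fintype X] [Nonempty X]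
    (ρ : X → Matrix (Fin 2) (Fin 2) ℂ)
    (hpsd : ∀ x, (ρ x).PosSemidef) (htr : ∀ x, (ρ x).trace = 1)
    (c : X → X) (hinv : ∀ x, c (c x) = x) (hfpf : ∀ x, c x ≠ x)
    (hopp : ∀ x, ρ (c x) = 1 - ρ x)
    (lam : ℝ)
    (hlam : IsGreatest {r : ℝ | ∃ x i, r = (hpsd x).1.eigenvalues i} lam)
    (hhalf : 1 / 2 < lam)
    (M : X → Matrix (Fin 2) (Fin 2) ℂ)
    (hMpsd : ∀ x, (M x).PosSemidef) (hMsum : ∑ x, M x = 1) :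
    (1 / (Fintype.card X) : ℝ) * ∑ x, ((ρ x * M x).trace).re
        = (2 / (Fintype.card X) : ℝ) * lam
      ↔ ∀ x, M x * ρ x = (lam : ℂ) • M x := by
  have hn : (Fintype.card X : ℝ) ≠ 0 := Nat.cast_ne_zero.mpr Fintype.card_ne_zero
  have hgap (x : X) : ((lam : ℂ) • (1 : Matrix (Fin 2) (Fin 2) ℂ) - ρ x).PosSemidef :=
    (hpsd x).1.posSemidef_smul_one_sub_s4 fun i => hlam.2 ⟨x, i, rfl⟩
  have htrace (x : X) := (hMpsd x).trace_mul_nonneg_and_eq_zero_iff (hgap x)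
  have hzero (x : X) : M x * ρ x = (lam : ℂ) • M x ↔
      ((M x * ((lam : ℂ) • 1 - ρ x)).trace).re = 0 := by
    have him := (Complex.nonneg_iff.mp (htrace x).1).2
    have hre : ((M x * ((lam : ℂ) • 1 - ρ x)).trace).re = 0 ↔
        (M x * ((lam : ℂ) • 1 - ρ x)).trace = 0 :=
      ⟨fun h => Complex.ext h him.symm, fun h => by rw [h, Complex.zero_re]⟩
    rw [hre, (htrace x).2, mul_sub, mul_smul_comm, mul_one, sub_eq_zero, eq_comm]
  have hMtrace : ∑ x, (M x).trace.re = 2 := by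
    rw [← Complex.re_sum, ← trace_sum, hMsum]
    simp
  have hsum : ∑ x, ((M x * ((lam : ℂ) • 1 - ρ x)).trace).re =
      2 * lam - ∑ x, ((ρ x * M x).trace).re := by
    have hterm (x : X) : ((M x * ((lam : ℂ) • 1 - ρ x)).trace).re =
        lam * (M x).trace.re - ((ρ x * M x).trace).re := by
      rw [mul_sub, trace_sub, trace_mul_comm (M x) (ρ x)]
      simp
    simp only [hterm, Finset.sum_sub_distrib, ← Finset.mul_sum, hMtrace, mul_comm]
  calc _ ↔ ∑ x, ((M x * ((lam : ℂ) • 1 - ρ x)).trace).re = 0 := by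
        rw [hsum, sub_eq_zero, eq_comm, div_mul_eq_mul_div, div_mul_eq_mul_div, one_mul,
          div_left_inj' hn]
    _ ↔ _ := by
        rw [Finset.sum_eq_zero_iff_of_nonneg fun x _ => (Complex.nonneg_iff.mp (htrace x).1).1]
        simp only [Finset.mem_univ, true_implies, hzero]
end

section
/- In the basis encoding scheme with k bases and the basis partition, the optimal success probability with metainformation followed by post-measurement side information is P_meta = 1/2 + (1/(2k)) · max_{p∈{+1,−1}^k} ‖∑_{i=1}^k p_i n_i‖. Precisely: the supremum, over all POVMs C with outcome set {+1,−1}^k, of (1/(2k)) ∑_{p∈{+1,−1}^k} ∑_{i=1}^k tr(ρ_{i,p_i} C(p)), equals 1/2 + (1/(2k)) max_{p∈{+1,−1}^k} ‖∑_i p_i n_i‖, where ‖·‖ is the Euclidean norm (note ‖∑_i p_i n_i‖ = √(∑_{i,j} p_i p_j ⟨n_i,n_j⟩)). -/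
open Matrix
open scoped ComplexOrder

noncomputable section

def σx : Matrix (Fin 2) (Fin 2) ℂ := !![0, 1; 1, 0]
def σy : Matrix (Fin 2) (Fin 2) ℂ := !![0, -Complex.I; Complex.I, 0]
def σz : Matrix (Fin 2) (Fin 2) ℂ := !![1, 0; 0, -1]

/-- `v ⬝ σ` for a Bloch vector `v ∈ ℝ³`. -/
def dotSigma (v : EuclideanSpace ℝ (Fin 3)) : Matrix (Fin 2) (Fin 2) ℂ :=
  v 0 • σx + v 1 • σy + v 2 • σz

/-- Sign of a parity bit: `true ↦ +1`, `false ↦ -1`. -/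
def sgn (b : Bool) : ℝ := if b then 1 else -1

/-- The qubit state `½(I + p · v ⬝ σ)`. -/
def basisState (v : EuclideanSpace ℝ (Fin 3)) (p : Bool) : Matrix (Fin 2) (Fin 2) ℂ :=
  (1 / 2 : ℝ) • (1 + sgn p • dotSigma v)

open scoped RealInnerProductSpace

/-- The Bloch vector `(tr (σx A), tr (σy A), tr (σz A))` of a qubit operator. -/
def blochVec (A : Matrix (Fin 2) (Fin 2) ℂ) : EuclideanSpace ℝ (Fin 3) :=
  !₂[(σx * A).trace.re, (σy * A).trace.re, (σz * A).trace.re]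

lemma blochVec_eq (A : Matrix (Fin 2) (Fin 2) ℂ) :
    blochVec A = !₂[(A 1 0).re + (A 0 1).re, (A 1 0).im - (A 0 1).im, (A 0 0).re - (A 1 1).re] := by
  ext j
  fin_cases j <;>
    simp [blochVec, σx, σy, σz, trace_fin_two, vecMul, dotProduct, Fin.sum_univ_two] <;> ring

lemma blochVec_basisState (v : EuclideanSpace ℝ (Fin 3)) (b : Bool) :
    blochVec (basisState v b) = sgn b • v := by
  ext j
  fin_cases j <;>
    simp [blochVec_eq, basisState, dotSigma, σx, σy, σz] <;>
    ring

lemma trace_basisState (v : EuclideanSpace ℝ (Fin 3)) (b : Bool) :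
    (basisState v b).trace = 1 := by
  simp [basisState, dotSigma, σx, σy, σz, trace_fin_two]

lemma re_trace_basisState_mul (v : EuclideanSpace ℝ (Fin 3)) (b : Bool)
    (A : Matrix (Fin 2) (Fin 2) ℂ) :
    (basisState v b * A).trace.re = 1 / 2 * (A.trace.re + ⟪sgn b • v, blochVec A⟫) := by
  simp [blochVec_eq, basisState, dotSigma, σx, σy, σz, trace_fin_two, mul_apply, Fin.sum_univ_two,
    PiLp.inner_apply, Fin.sum_univ_three]
  ring

lemma sum_re_trace_basisState_mul {k : ℕ} (n : Fin k → EuclideanSpace ℝ (Fin 3))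
    (p : Fin k → Bool) (A : Matrix (Fin 2) (Fin 2) ℂ) :
    ∑ i, (basisState (n i) (p i) * A).trace.re =
      k / 2 * A.trace.re + 1 / 2 * ⟪∑ i, sgn (p i) • n i, blochVec A⟫ := by
  simp_rw [re_trace_basisState_mul, sum_inner, ← Finset.mul_sum, Finset.sum_add_distrib]
  simp
  ring

lemma norm_blochVec_le_re_trace {A : Matrix (Fin 2) (Fin 2) ℂ} (hA : A.PosSemidef) :
    ‖blochVec A‖ ≤ A.trace.re := by
  have htr := (Complex.nonneg_iff.mp hA.trace_nonneg).1
  have hdet := (Complex.nonneg_iff.mp hA.det_nonneg).1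
  have h10 : A 1 0 = star (A 0 1) := (hA.isHermitian.apply 1 0).symm
  have h0 := congrArg Complex.im (hA.isHermitian.apply 0 0)
  have h1 := congrArg Complex.im (hA.isHermitian.apply 1 1)
  refine abs_le_of_sq_le_sq' ?_ htr |>.2
  rw [EuclideanSpace.norm_sq_eq]
  simp [det_fin_two, h10] at hdet h0 h1
  have h0' : (A 0 0).im = 0 := by linarith
  have h1' : (A 1 1).im = 0 := by linarith
  simp [blochVec_eq, trace_fin_two, Fin.sum_univ_three, h10, h0', h1'] at hdet ⊢
  nlinarith

lemma posSemidef_of_trace_nonneg_of_det_nonneg {A : Matrix (Fin 2) (Fin 2) ℂ}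
    (hA : A.IsHermitian) (htr : 0 ≤ A.trace.re) (hdet : 0 ≤ A.det.re) : A.PosSemidef := by
  rw [hA.posSemidef_iff_eigenvalues_nonneg]
  rw [hA.trace_eq_sum_eigenvalues] at htr
  rw [hA.det_eq_prod_eigenvalues] at hdet
  simp [Fin.sum_univ_two, Fin.prod_univ_two] at htr hdet
  intro i
  fin_cases i <;> simp <;> by_contra! h <;> nlinarith

lemma posSemidef_basisState {v : EuclideanSpace ℝ (Fin 3)} (hv : ‖v‖ ≤ 1) (b : Bool) :
    (basisState v b).PosSemidef := by
  refine posSemidef_of_trace_nonneg_of_det_nonneg ?_ (by simp [trace_basisState]) ?_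
  · ext i j
    fin_cases i <;> fin_cases j <;> simp [basisState, dotSigma, σx, σy, σz]
  · have h : v 0 ^ 2 + v 1 ^ 2 + v 2 ^ 2 ≤ 1 := by
      have := EuclideanSpace.real_norm_sq_eq v
      rw [Fin.sum_univ_three] at this
      nlinarith [norm_nonneg v]
    cases b <;> simp [basisState, dotSigma, σx, σy, σz, det_fin_two, sgn] <;> nlinarith

lemma basisState_true_add_false (v : EuclideanSpace ℝ (Fin 3)) :
    basisState v true + basisState v false = 1 := by
  simp only [basisState, sgn, if_true, Bool.false_eq_true, if_false]
  module

lemma sgn_not (b : Bool) : sgn (!b) = -sgn b := by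
  cases b <;> simp [sgn]

/-- Basis encoding with `k` bases and the basis partition: the optimal success
probability with metainformation followed by post-measurement side information, i.e. the optimum
over all POVMs `C` indexed by parity vectors `p ∈ {+1,-1}^k` of
`(1/(2k)) ∑_p ∑_i tr(ρ_{i, p i} C p)`, equals
`1/2 + (1/(2k)) · max_{p} ‖∑_i p_i n_i‖`. -/
theorem meta_info_value_basis_partition
    (k : ℕ) (hk : 0 < k) (n : Fin k → EuclideanSpace ℝ (Fin 3))
    (hn : ∀ i, ‖n i‖ = 1) :
    IsGreatest {P : ℝ | ∃ C : (Fin k → Bool) → Matrix (Fin 2) (Fin 2) ℂ,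
        (∀ p, (C p).PosSemidef) ∧ (∑ p, C p = 1) ∧
        P = (1 / (2 * k) : ℝ) * ∑ p : Fin k → Bool, ∑ i : Fin k,
              ((basisState (n i) (p i) * C p).trace).re}
      (1 / 2 + (1 / (2 * k) : ℝ) *
        Finset.univ.sup' ⟨(fun _ => true : Fin k → Bool), Finset.mem_univ _⟩
          (fun p : Fin k → Bool => ‖∑ i, sgn (p i) • n i‖)) := by
  have hk' : (k : ℝ) ≠ 0 := by positivity
  constructor
  · obtain ⟨q, -, hq⟩ := Finset.exists_mem_eq_sup' ⟨(fun _ => true : Fin k → Bool),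
      Finset.mem_univ _⟩ (fun p : Fin k → Bool => ‖∑ i, sgn (p i) • n i‖)
    rw [hq]
    set S := ∑ i, sgn (q i) • n i with hS
    set u := ‖S‖⁻¹ • S with hu
    have hu1 : ‖u‖ ≤ 1 := by
      rw [hu, norm_smul, norm_inv, norm_norm]
      exact inv_mul_le_one
    have hSu : ⟪S, u⟫ = ‖S‖ := by
      rw [hu, real_inner_smul_right, real_inner_self_eq_norm_sq]
      rcases eq_or_ne ‖S‖ 0 with h | h
      · simp [h]
      · field_simp
    have hneg : ∑ i, sgn (!q i) • n i = -S := by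
      simp [sgn_not, hS]
    refine ⟨fun p => (if p = q then basisState u true else 0) +
      (if p = fun i => !q i then basisState u false else 0), fun p => ?_, ?_, ?_⟩
    · refine PosSemidef.add ?_ ?_ <;> split_ifs <;>
        first | exact posSemidef_basisState hu1 _ | exact PosSemidef.zero
    · simp [Finset.sum_add_distrib, basisState_true_add_false]
    · simp only [mul_add, trace_add, Complex.add_re, Finset.sum_add_distrib, mul_ite, mul_zero,
        apply_ite trace, apply_ite Complex.re, trace_zero, Complex.zero_re,
        Finset.sum_ite_irrel, Finset.sum_const_zero, Finset.sum_ite_eq', Finset.mem_univ, if_true]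
      rw [sum_re_trace_basisState_mul, sum_re_trace_basisState_mul n (fun i => !q i), hneg, ← hS]
      simp only [trace_basisState, blochVec_basisState, sgn, if_true, Bool.false_eq_true, if_false,
        one_smul, neg_smul, inner_neg_neg, hSu, Complex.one_re]
      field_simp
      ring
  · rintro P ⟨C, hC, hsum, rfl⟩
    set M := Finset.univ.sup' ⟨(fun _ => true : Fin k → Bool), Finset.mem_univ _⟩
      (fun p : Fin k → Bool => ‖∑ i, sgn (p i) • n i‖)
    have htr : ∑ p, (C p).trace.re = 2 := by
      rw [← Complex.re_sum, ← trace_sum, hsum]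
      simp
    have hle : ∑ p, ∑ i, (basisState (n i) (p i) * C p).trace.re ≤ k + M := by
      calc
        _ ≤ ∑ p, (k / 2 + 1 / 2 * M) * (C p).trace.re := by
          refine Finset.sum_le_sum fun p _ => ?_
          rw [sum_re_trace_basisState_mul]
          have hM : ‖∑ i, sgn (p i) • n i‖ ≤ M :=
            Finset.le_sup' (fun p : Fin k → Bool => ‖∑ i, sgn (p i) • n i‖) (Finset.mem_univ p)
          have hinner := (real_inner_le_norm (∑ i, sgn (p i) • n i) (blochVec (C p))).trans
            (mul_le_mul hM (norm_blochVec_le_re_trace (hC p)) (norm_nonneg _)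
              ((norm_nonneg _).trans hM))
          linarith
        _ = k + M := by
          rw [← Finset.mul_sum, htr]
          ring
    calc
      _ ≤ (1 / (2 * k) : ℝ) * (k + M) := by gcongr
      _ = _ := by
        field_simp
end
end

section
/- Let 0 < θ < π and consider the four qubit states ρ_{1,±} = ½(I ± (sin(θ/2)·σx + cos(θ/2)·σz)) and ρ_{2,±} = ½(I ± (−sin(θ/2)·σx + cos(θ/2)·σz)) with uniform prior 1/4, partitioned by basis into X_1 = {(1,+),(1,−)} and X_2 = {(2,+),(2,−)}. Then the optimal success probability with metainformation followed by post-measurement side information equals P_meta = ½(1 + √((1 + |cos θ|)/2)). Precisely: the supremum, over all POVMs C with outcome set {+1,−1}², of (1/4) ∑_{p∈{+1,−1}²} [tr(ρ_{1,p_1} C(p)) + tr(ρ_{2,p_2} C(p))], equals ½(1 + √((1 + |cos θ|)/2)). -/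
open Matrix
open scoped ComplexOrder

noncomputable section

/-- The four states of the two-basis encoding:
`ρ_{1,±} = ½(I ± (sin(θ/2)σx + cos(θ/2)σz))` and
`ρ_{2,±} = ½(I ± (-sin(θ/2)σx + cos(θ/2)σz))`. -/
def twoBasisState (θ : ℝ) (i : Fin 2) (p : Bool) : Matrix (Fin 2) (Fin 2) ℂ :=
  (1 / 2 : ℝ) • ((1 : Matrix (Fin 2) (Fin 2) ℂ)
    + (sgn p * (if i = 0 then 1 else -1) * Real.sin (θ / 2)) • σx
    + (sgn p * Real.cos (θ / 2)) • σz)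

theorem re_trace_twoBasisState_mul (θ : ℝ) (i : Fin 2) (p : Bool)
    (M : Matrix (Fin 2) (Fin 2) ℂ) :
    ((twoBasisState θ i p * M).trace).re =
      (1 / 2) * (((M 0 0).re + (M 1 1).re)
        + sgn p * (if i = 0 then 1 else -1) * Real.sin (θ / 2) * ((M 0 1).re + (M 1 0).re)
        + sgn p * Real.cos (θ / 2) * ((M 0 0).re - (M 1 1).re)) := by
  simp only [twoBasisState, σx, σz, Matrix.trace_fin_two, Matrix.mul_apply, Fin.sum_univ_two,
    Matrix.smul_apply, Matrix.add_apply, Matrix.one_apply, Matrix.of_apply, Matrix.cons_val_zero,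
    Matrix.cons_val_one, Complex.add_re, Complex.mul_re, Complex.real_smul]
  generalize Real.sin (θ / 2) = s
  generalize Real.cos (θ / 2) = c
  simp
  split_ifs <;> ring

/-- The contribution of a POVM element `M` with guesses `p`, `q`, in Pauli components. -/
theorem re_trace_pair (θ : ℝ) (p q : Bool) (M : Matrix (Fin 2) (Fin 2) ℂ) :
    ((twoBasisState θ 0 p * M).trace).re + ((twoBasisState θ 1 q * M).trace).re =
      ((M 0 0).re + (M 1 1).re)
        + (sgn p - sgn q) / 2 * Real.sin (θ / 2) * ((M 0 1).re + (M 1 0).re)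
        + (sgn p + sgn q) / 2 * Real.cos (θ / 2) * ((M 0 0).re - (M 1 1).re) := by
  rw [re_trace_twoBasisState_mul, re_trace_twoBasisState_mul]
  simp
  ring

/-- The `σx` and `σz` components of a positive semidefinite matrix are bounded by its trace. -/
theorem Matrix.PosSemidef.abs_pauli_le {M : Matrix (Fin 2) (Fin 2) ℂ} (hM : M.PosSemidef) :
    |(M 0 1).re + (M 1 0).re| ≤ (M 0 0).re + (M 1 1).re ∧
      |(M 0 0).re - (M 1 1).re| ≤ (M 0 0).re + (M 1 1).re := by
  have key (x y : ℝ) : 0 ≤ x ^ 2 * (M 0 0).re + x * y * ((M 0 1).re + (M 1 0).re)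
      + y ^ 2 * (M 1 1).re := by
    have h := (Complex.le_def.mp (hM.dotProduct_mulVec_nonneg ![(x : ℂ), (y : ℂ)])).1
    simp [dotProduct, Matrix.mulVec, Fin.sum_univ_two] at h
    linarith
  constructor <;> rw [abs_le] <;> constructor <;>
    linarith [key 1 0, key 0 1, key 1 1, key 1 (-1)]

theorem max_cos_sin_half_eq_sqrt {θ : ℝ} (hc : 0 ≤ Real.cos (θ / 2))
    (hs : 0 ≤ Real.sin (θ / 2)) :
    max (Real.cos (θ / 2)) (Real.sin (θ / 2)) = √((1 + |Real.cos θ|) / 2) := by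
  have h1 := Real.sin_sq_add_cos_sq (θ / 2)
  have h2 : Real.cos θ = 2 * Real.cos (θ / 2) ^ 2 - 1 := by
    rw [← Real.cos_two_mul, mul_div_cancel₀ θ two_ne_zero]
  symm
  rcases le_total (Real.sin (θ / 2)) (Real.cos (θ / 2)) with h | h
  · rw [max_eq_left h, abs_of_nonneg (by nlinarith), Real.sqrt_eq_iff_mul_self_eq] <;> nlinarith
  · rw [max_eq_right h, abs_of_nonpos (by nlinarith), Real.sqrt_eq_iff_mul_self_eq] <;> nlinarith

theorem re_trace_pair_le {θ : ℝ} (hc : 0 ≤ Real.cos (θ / 2)) (hs : 0 ≤ Real.sin (θ / 2))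
    (p q : Bool) {M : Matrix (Fin 2) (Fin 2) ℂ} (hM : M.PosSemidef) :
    ((twoBasisState θ 0 p * M).trace).re + ((twoBasisState θ 1 q * M).trace).re ≤
      (1 + max (Real.cos (θ / 2)) (Real.sin (θ / 2))) * ((M 0 0).re + (M 1 1).re) := by
  obtain ⟨hx, hz⟩ := hM.abs_pauli_le
  have hT : 0 ≤ (M 0 0).re + (M 1 1).re := (abs_nonneg _).trans hx
  have hcT := mul_le_mul_of_nonneg_right
    (le_max_left (Real.cos (θ / 2)) (Real.sin (θ / 2))) hT
  have hsT := mul_le_mul_of_nonneg_right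
    (le_max_right (Real.cos (θ / 2)) (Real.sin (θ / 2))) hT
  rw [abs_le] at hx hz
  rw [re_trace_pair]
  cases p <;> cases q <;> norm_num [sgn] <;>
    linarith [mul_le_mul_of_nonneg_left hx.1 hs, mul_le_mul_of_nonneg_left hx.2 hs,
      mul_le_mul_of_nonneg_left hz.1 hc, mul_le_mul_of_nonneg_left hz.2 hc]

theorem posSemidef_half_one_add_sgn_smul_sigma (b : Bool) :
    (!![1 / 2, (sgn b / 2 : ℂ); (sgn b / 2 : ℂ), 1 / 2]).PosSemidef := by
  have h := Matrix.posSemidef_vecMulVec_self_star ![(1 : ℂ), (sgn b : ℂ)]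
  convert h.smul (show (0 : ℝ) ≤ 1 / 2 by norm_num) using 1
  ext i j
  rw [Matrix.smul_apply, Matrix.vecMulVec_apply]
  fin_cases i <;> fin_cases j <;> cases b <;> norm_num [sgn]

/-- For the two-basis qubit encoding with basis partition
`X_i = {(i,+),(i,-)}` and `0 < θ < π`, the optimal success probability with metainformation
followed by post-measurement side information, i.e. the optimum over POVMs `C` indexed by
`{+1,-1}²` of `(1/4) ∑_p (tr(ρ_{1,p₁} C p) + tr(ρ_{2,p₂} C p))`, equals
`½(1 + √((1 + |cos θ|)/2))`. -/
theorem meta_value_two_bases_basis_partition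
    (θ : ℝ) (h0 : 0 < θ) (hπ : θ < Real.pi) :
    IsGreatest {P : ℝ | ∃ C : Bool × Bool → Matrix (Fin 2) (Fin 2) ℂ,
        (∀ p, (C p).PosSemidef) ∧ (∑ p, C p = 1) ∧
        P = (1 / 4 : ℝ) * ∑ p : Bool × Bool,
              (((twoBasisState θ 0 p.1 * C p).trace).re +
                ((twoBasisState θ 1 p.2 * C p).trace).re)}
      ((1 / 2 : ℝ) * (1 + Real.sqrt ((1 + |Real.cos θ|) / 2))) := by
  have hc : 0 ≤ Real.cos (θ / 2) := Real.cos_nonneg_of_mem_Icc ⟨by linarith, by linarith⟩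
  have hs : 0 ≤ Real.sin (θ / 2) := Real.sin_nonneg_of_nonneg_of_le_pi (by linarith) (by linarith)
  rw [← max_cos_sin_half_eq_sqrt hc hs]
  constructor
  · rcases le_total (Real.sin (θ / 2)) (Real.cos (θ / 2)) with h | h
    · refine ⟨fun p => if p.1 = p.2 then
        Matrix.diagonal (if p.1 then ![1, 0] else ![0, 1]) else 0, ?_, ?_, ?_⟩
      · rintro ⟨p, q⟩
        cases p <;> cases q <;>
          simp [Matrix.PosSemidef.zero, Matrix.posSemidef_diagonal_iff, Fin.forall_fin_two]
      · ext i j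
        fin_cases i <;> fin_cases j <;> simp [Fintype.sum_prod_type]
      · simp only [re_trace_pair, Fintype.sum_prod_type, Fintype.sum_bool, max_eq_left h]
        norm_num [sgn]
        ring
    · refine ⟨fun p => if p.1 = p.2 then 0 else
        !![1 / 2, (sgn p.1 / 2 : ℂ); (sgn p.1 / 2 : ℂ), 1 / 2], ?_, ?_, ?_⟩
      · rintro ⟨p, q⟩
        dsimp only
        split_ifs
        · exact Matrix.PosSemidef.zero
        · exact posSemidef_half_one_add_sgn_smul_sigma p
      · ext i j
        fin_cases i <;> fin_cases j <;> norm_num [Fintype.sum_prod_type, sgn]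
      · simp only [re_trace_pair, Fintype.sum_prod_type, Fintype.sum_bool, max_eq_right h]
        norm_num [sgn]
        ring
  · rintro _ ⟨C, hC, hsum, rfl⟩
    have htr : ∑ p, ((C p 0 0).re + (C p 1 1).re) = 2 := by
      have h := congrArg (fun M : Matrix (Fin 2) (Fin 2) ℂ => (M 0 0).re + (M 1 1).re) hsum
      simp only [Matrix.sum_apply, Complex.re_sum, ← Finset.sum_add_distrib] at h
      rw [h]
      norm_num
    have hle := Finset.sum_le_sum fun p (_ : p ∈ Finset.univ) =>
      re_trace_pair_le hc hs p.1 p.2 (hC p)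
    rw [← Finset.mul_sum, htr] at hle
    linarith
end
end

section
/- Let 0 < θ < π and consider the four qubit states ρ_{1,±} = ½(I ± (sin(θ/2)·σx + cos(θ/2)·σz)) and ρ_{2,±} = ½(I ± (−sin(θ/2)·σx + cos(θ/2)·σz)) with uniform prior 1/4, partitioned by basis into X_1 = {(1,+),(1,−)} and X_2 = {(2,+),(2,−)}. Then the optimal success probability with post-measurement side information (without metainformation) equals P_post = ¼(3 + |cos θ|). Precisely: the supremum, over all weights t_1, t_2 ≥ 0 with t_1 + t_2 = 1 and all relabeling maps f_i from the four outcomes into X_i, of ∑_{i=1}^2 ∑_{(j,p)} (1/4) tr(ρ_{f_i(j,p)} M_t(j,p)), where M_t(j,p) = t_j ρ_{j,p}, equals ¼(3 + |cos θ|). -/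
open Matrix
open scoped ComplexOrder

noncomputable section

/-- The Born probability of two encoding states in terms of the angle between their Bloch
vectors. -/
lemma re_trace_twoBasisState_mul_smul (θ t : ℝ) (i j : Fin 2) (p q : Bool) :
    ((twoBasisState θ i p * (t • twoBasisState θ j q)).trace).re
      = t / 2 * (1 + sgn p * sgn q * (if i = j then 1 else Real.cos θ)) := by
  have hc : Real.cos θ = Real.cos (θ / 2) ^ 2 - Real.sin (θ / 2) ^ 2 := by
    rw [← Real.cos_two_mul']
    ring_nf
  have hs := Real.sin_sq_add_cos_sq (θ / 2)
  rw [hc]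
  unfold twoBasisState
  generalize Real.sin (θ / 2) = s at *
  generalize Real.cos (θ / 2) = c at *
  generalize sgn p = a
  generalize sgn q = b
  fin_cases i <;> fin_cases j <;>
    simp [σx, σz, Matrix.trace_fin_two, Matrix.mul_apply] <;>
    first
    | ring1
    | linear_combination (t / 2 * a * b) * hs

lemma sgn_mul_sgn_mul_le_abs (p q : Bool) (x : ℝ) : sgn p * sgn q * x ≤ |x| := by
  cases p <;> cases q <;> simp [sgn, le_abs_self, neg_le_abs]

/-- For the two-basis qubit encoding with basis partition
`X_i = {(i,+),(i,-)}` and `0 < θ < π`, the optimal success probability with post-measurement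
side information (without metainformation), i.e. the optimum over standard measurements
`M_t(j,p) = t j • ρ_{j,p}` (weights `t` in the simplex) and relabeling maps
`f i : outcomes → X_i` (recorded by the guessed parity), equals `¼(3 + |cos θ|)`. -/
theorem post_value_two_bases_basis_partition
    (θ : ℝ) (h0 : 0 < θ) (hπ : θ < Real.pi) :
    IsGreatest {P : ℝ | ∃ t : Fin 2 → ℝ, (∀ j, 0 ≤ t j) ∧ (∑ j, t j = 1) ∧
        ∃ f : Fin 2 → Fin 2 × Bool → Bool,
          P = ∑ i : Fin 2, ∑ j : Fin 2, ∑ p : Bool,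
            (1 / 4 : ℝ) *
              ((twoBasisState θ i (f i (j, p)) * (t j • twoBasisState θ j p)).trace).re}
      ((1 / 4 : ℝ) * (3 + |Real.cos θ|)) := by
  simp only [re_trace_twoBasisState_mul_smul]
  constructor
  · refine ⟨![1, 0], fun j => by fin_cases j <;> simp, by simp,
      fun i o => if i = o.1 ∨ 0 ≤ Real.cos θ then o.2 else !o.2, ?_⟩
    by_cases hc : 0 ≤ Real.cos θ
    · simp [hc, sgn, abs_of_nonneg hc]
      ring
    · simp [hc, sgn, abs_of_neg (not_le.mp hc)]
      ring
  · rintro P ⟨t, ht, hsum, f, rfl⟩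
    calc _ ≤ ∑ i : Fin 2, ∑ j : Fin 2, ∑ _p : Bool,
          (1 / 4 : ℝ) * (t j / 2 * (1 + |if i = j then 1 else Real.cos θ|)) := by
          gcongr with i _ j _ p _
          · exact div_nonneg (ht j) zero_le_two
          · exact sgn_mul_sgn_mul_le_abs _ _ _
      _ = (1 / 4 : ℝ) * (3 + |Real.cos θ|) := by
          simp [Fin.sum_univ_two] at hsum ⊢
          linear_combination (1 / 4 * (3 + |Real.cos θ|)) * hsum
end
end

section
/- For every θ with 0 < θ < π, the strict chain of inequalities 1 > ½(1 + √((1 + |cos θ|)/2)) > ¼(3 + |cos θ|) > ½ holds. These are respectively the values P_pre, P_meta, P_post, and P for the two-basis qubit encoding with basis side information, so P_pre > P_meta > P_post > P for all 0 < θ < π. -/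
theorem Real.lt_sqrt_self {x : ℝ} (h0 : 0 < x) (h1 : x < 1) : x < √x :=
  Real.lt_sqrt_of_sq_lt (by nlinarith)

theorem Real.abs_cos_lt_one_of_mem_Ioo {θ : ℝ} (h0 : 0 < θ) (hπ : θ < Real.pi) :
    |Real.cos θ| < 1 := by
  have hsin := Real.sin_pos_of_pos_of_lt_pi h0 hπ
  rw [← sq_lt_one_iff_abs_lt_one]
  nlinarith [Real.sin_sq_add_cos_sq θ]

/-- The strict chain of Eq. (5): for `0 < θ < π`,
`P_pre = 1 > P_meta = ½(1 + √((1 + |cos θ|)/2)) > P_post = ¼(3 + |cos θ|) > P = ½`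
for the two-basis qubit encoding with basis side information. -/
theorem strict_chain_two_bases_basis_partition
    (θ : ℝ) (h0 : 0 < θ) (hπ : θ < Real.pi) :
    1 > (1 / 2 : ℝ) * (1 + Real.sqrt ((1 + |Real.cos θ|) / 2)) ∧
    (1 / 2 : ℝ) * (1 + Real.sqrt ((1 + |Real.cos θ|) / 2)) > (1 / 4 : ℝ) * (3 + |Real.cos θ|) ∧
    (1 / 4 : ℝ) * (3 + |Real.cos θ|) > 1 / 2 := by
  have hc0 := abs_nonneg (Real.cos θ)
  have hc1 := Real.abs_cos_lt_one_of_mem_Ioo h0 hπ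
  have hx0 : 0 < (1 + |Real.cos θ|) / 2 := by linarith
  have hx1 : (1 + |Real.cos θ|) / 2 < 1 := by linarith
  have hlt := Real.lt_sqrt_self hx0 hx1
  have hsqrt : √((1 + |Real.cos θ|) / 2) < 1 := by
    rwa [Real.sqrt_lt' one_pos, one_pow]
  exact ⟨by linarith, by linarith, by linarith⟩
end

section
/- Let 0 < θ < π and consider the four qubit states ρ_{1,±} = ½(I ± (sin(θ/2)·σx + cos(θ/2)·σz)) and ρ_{2,±} = ½(I ± (−sin(θ/2)·σx + cos(θ/2)·σz)) with uniform prior 1/4, partitioned by parity into X_+ = {(1,+),(2,+)} and X_− = {(1,−),(2,−)}. Then: (a) for each parity p ∈ {+,−}, the supremum over POVMs (M(1), M(2)) of ½ tr(ρ_{1,p} M(1)) + ½ tr(ρ_{2,p} M(2)) equals ½(1 + sin(θ/2)) (so P_pre = ½(1 + sin(θ/2))); and (b) the supremum over POVMs C with outcome set {1,2}² of (1/4) ∑_{i,j∈{1,2}} [tr(ρ_{i,+} C(i,j)) + tr(ρ_{j,−} C(i,j))] also equals ½(1 + sin(θ/2)) (so P_meta = P_pre). -/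
open Matrix
open scoped ComplexOrder

noncomputable section

lemma trace_twoBasisState_mul_re (θ : ℝ) (i : Fin 2) (p : Bool)
    (M : Matrix (Fin 2) (Fin 2) ℂ) :
    ((twoBasisState θ i p * M).trace).re =
      (1 / 2 : ℝ) * ((M 0 0).re + (M 1 1).re
        + sgn p * (if i = 0 then 1 else -1) * Real.sin (θ / 2) * ((M 0 1).re + (M 1 0).re)
        + sgn p * Real.cos (θ / 2) * ((M 0 0).re - (M 1 1).re)) := by
  simp only [twoBasisState, σx, σz, Matrix.trace_fin_two, Matrix.mul_apply, Fin.sum_univ_two,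
    Matrix.smul_apply, Matrix.add_apply, Matrix.one_apply, Matrix.of_apply, Matrix.cons_val',
    Matrix.cons_val_zero, Matrix.cons_val_one, Matrix.cons_val_fin_one, Complex.add_re,
    Complex.mul_re, Complex.smul_re, Complex.smul_im, Complex.add_im, Complex.one_re,
    Complex.one_im, Complex.zero_re, Complex.zero_im, Complex.neg_re, Complex.neg_im,
    Fin.zero_eq_one_iff, Fin.one_eq_zero_iff, smul_eq_mul, ↓reduceIte, OfNat.ofNat_ne_one]
  ring

lemma Matrix.PosSemidef.abs_offDiag_re_le {M : Matrix (Fin 2) (Fin 2) ℂ} (hM : M.PosSemidef) :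
    |(M 0 1).re + (M 1 0).re| ≤ (M 0 0).re + (M 1 1).re := by
  have hplus := (Complex.le_def.1 (hM.dotProduct_mulVec_nonneg ![1, 1])).1
  have hminus := (Complex.le_def.1 (hM.dotProduct_mulVec_nonneg ![1, -1])).1
  simp [dotProduct, Matrix.mulVec, Fin.sum_univ_two] at hplus hminus
  rw [abs_le]
  constructor <;> linarith

/-- The projection `½(1 + εσx)` onto an eigenvector of `σx`. -/
def xProj (ε : ℝ) : Matrix (Fin 2) (Fin 2) ℂ :=
  (1 / 2 : ℝ) • ((1 : Matrix (Fin 2) (Fin 2) ℂ) + ε • σx)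

lemma xProj_eq (ε : ℝ) :
    xProj ε = !![1 / 2, (ε : ℂ) / 2; (ε : ℂ) / 2, 1 / 2] := by
  ext i j
  fin_cases i <;> fin_cases j <;> simp [xProj, σx] <;> ring

lemma xProj_posSemidef {ε : ℝ} (hε : ε ^ 2 = 1) : (xProj ε).PosSemidef := by
  have hc : (ε : ℂ) ^ 2 = 1 := by exact_mod_cast hε
  have h : xProj ε = (xProj ε)ᴴ * xProj ε := by
    rw [xProj_eq]
    ext i j
    fin_cases i <;> fin_cases j <;>
      simp [Matrix.mul_apply, Fin.sum_univ_two, Complex.conj_ofNat] <;>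
      first | ring1 | linear_combination (-1 / 4 : ℂ) * hc
  rw [h]
  exact Matrix.posSemidef_conjTranspose_mul_self _

lemma xProj_add_xProj_neg (ε : ℝ) : xProj ε + xProj (-ε) = 1 := by
  rw [xProj_eq, xProj_eq]
  ext i j
  fin_cases i <;> fin_cases j <;> norm_num <;> ring

lemma sgn_sq (p : Bool) : sgn p ^ 2 = 1 := by
  cases p <;> norm_num [sgn]

lemma sum_entry_re {ι : Type*} [Fintype ι] {M : ι → Matrix (Fin 2) (Fin 2) ℂ}
    (h : ∑ k, M k = 1) (i j : Fin 2) : ∑ k, (M k i j).re = if i = j then 1 else 0 := by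
  rw [← Complex.re_sum, ← Matrix.sum_apply, h, Matrix.one_apply]
  split <;> simp

/-- For the two-basis qubit encoding with parity partition
`X_p = {(1,p),(2,p)}` and `0 < θ < π`:
(a) for each parity `p`, the optimal discrimination of the two equiprobable states
`ρ_{1,p}, ρ_{2,p}` over all two-outcome POVMs equals `½(1 + sin(θ/2))` (so
`P_pre = ½(1 + sin(θ/2))`); and
(b) the optimum over POVMs `C` indexed by `{1,2}²` of
`¼ ∑_{i,j} (tr(ρ_{i,+} C(i,j)) + tr(ρ_{j,-} C(i,j)))` is also `½(1 + sin(θ/2))`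
(so `P_meta = P_pre`). -/
theorem pre_eq_meta_two_bases_parity_partition
    (θ : ℝ) (h0 : 0 < θ) (hπ : θ < Real.pi) :
    (∀ p : Bool,
      IsGreatest {P : ℝ | ∃ M : Fin 2 → Matrix (Fin 2) (Fin 2) ℂ,
          (∀ i, (M i).PosSemidef) ∧ (∑ i, M i = 1) ∧
          P = (1 / 2 : ℝ) * ((twoBasisState θ 0 p * M 0).trace).re
            + (1 / 2 : ℝ) * ((twoBasisState θ 1 p * M 1).trace).re}
        ((1 / 2 : ℝ) * (1 + Real.sin (θ / 2)))) ∧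
    IsGreatest {P : ℝ | ∃ C : Fin 2 × Fin 2 → Matrix (Fin 2) (Fin 2) ℂ,
        (∀ ij, (C ij).PosSemidef) ∧ (∑ ij, C ij = 1) ∧
        P = (1 / 4 : ℝ) * ∑ ij : Fin 2 × Fin 2,
              (((twoBasisState θ ij.1 true * C ij).trace).re +
                ((twoBasisState θ ij.2 false * C ij).trace).re)}
      ((1 / 2 : ℝ) * (1 + Real.sin (θ / 2))) := by
  have hS : 0 ≤ Real.sin (θ / 2) :=
    Real.sin_nonneg_of_nonneg_of_le_pi (by linarith) (by linarith)
  refine ⟨fun p => ⟨⟨![xProj (sgn p), xProj (-sgn p)], ?_, ?_, ?_⟩, ?_⟩,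
    ⟨⟨fun ij => ![![0, xProj 1], ![xProj (-1), 0]] ij.1 ij.2, ?_, ?_, ?_⟩, ?_⟩⟩
  · intro i
    fin_cases i
    · exact xProj_posSemidef (sgn_sq p)
    · exact xProj_posSemidef (by rw [neg_sq, sgn_sq])
  · simpa [Fin.sum_univ_two] using xProj_add_xProj_neg (sgn p)
  · simp only [trace_twoBasisState_mul_re, xProj_eq]
    cases p <;> simp [sgn] <;> ring
  · rintro P ⟨M, hM, hsum, rfl⟩
    have h00 := sum_entry_re hsum 0 0
    have h11 := sum_entry_re hsum 1 1
    have b0 := abs_le.1 (hM 0).abs_offDiag_re_le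
    have b1 := abs_le.1 (hM 1).abs_offDiag_re_le
    simp only [Fin.sum_univ_two, ↓reduceIte] at h00 h11
    have key : sgn p * (((M 0 0 1).re + (M 0 1 0).re) - ((M 1 0 1).re + (M 1 1 0).re)) ≤ 2 := by
      cases p <;> simp [sgn] <;> linarith
    have := mul_le_mul_of_nonneg_left key hS
    simp only [trace_twoBasisState_mul_re, ↓reduceIte, one_ne_zero]
    linear_combination (1 / 4 : ℝ) * this
      + (1 / 4 + sgn p * Real.cos (θ / 2) / 4) * h00
      + (1 / 4 - sgn p * Real.cos (θ / 2) / 4) * h11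
  · rintro ⟨i, j⟩
    fin_cases i <;> fin_cases j
    · exact Matrix.PosSemidef.zero
    · exact xProj_posSemidef (by norm_num)
    · exact xProj_posSemidef (by norm_num)
    · exact Matrix.PosSemidef.zero
  · simpa [Fintype.sum_prod_type, Fin.sum_univ_two] using xProj_add_xProj_neg 1
  · simp only [trace_twoBasisState_mul_re, xProj_eq]
    simp [Fintype.sum_prod_type, Fin.sum_univ_two, sgn]
    ring
  · rintro P ⟨C, hC, hsum, rfl⟩
    have h00 := sum_entry_re hsum 0 0
    have h11 := sum_entry_re hsum 1 1
    have b00 := (abs_nonneg _).trans (hC (0, 0)).abs_offDiag_re_le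
    have b01 := abs_le.1 (hC (0, 1)).abs_offDiag_re_le
    have b10 := abs_le.1 (hC (1, 0)).abs_offDiag_re_le
    have b11 := (abs_nonneg _).trans (hC (1, 1)).abs_offDiag_re_le
    simp only [Fintype.sum_prod_type, Fin.sum_univ_two, ↓reduceIte] at h00 h11
    have key : ((C (0, 1) 0 1).re + (C (0, 1) 1 0).re)
        - ((C (1, 0) 0 1).re + (C (1, 0) 1 0).re) ≤ 2 := by
      linarith
    have := mul_le_mul_of_nonneg_left key hS
    simp only [trace_twoBasisState_mul_re, Fintype.sum_prod_type, Fin.sum_univ_two, ↓reduceIte,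
      one_ne_zero, sgn, Bool.false_eq_true]
    linear_combination (1 / 4 : ℝ) * this + (1 / 4 : ℝ) * h00 + (1 / 4 : ℝ) * h11
end
end

section
/- Consider the six pure qubit states ρ_{j,±} = ½(I ± (sin(jπ/3)·σx + cos(jπ/3)·σz)), j = 1, 2, 3, with uniform prior 1/6 (three bases equally separated in a plane), partitioned by basis into X_j = {(j,+),(j,−)}. Then P_meta = P_post = 5/6. Precisely: (a) the supremum over POVMs C with outcome set {+1,−1}³ of (1/6) ∑_{p∈{+1,−1}³} ∑_{j=1}^3 tr(ρ_{j,p_j} C(p)) equals 5/6; and (b) the supremum over weights t (t_j ≥ 0, ∑ t_j = 1) and relabeling maps f_i into X_i of ∑_{i=1}^3 ∑_{(j,p)} (1/6) tr(ρ_{f_i(j,p)} M_t(j,p)), where M_t(j,p) = t_j ρ_{j,p}, also equals 5/6. -/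
open Matrix
open scoped ComplexOrder

noncomputable section

/-- The six states `ρ_{j,±} = ½(I ± (sin(jπ/3)σx + cos(jπ/3)σz))`, `j = 1, 2, 3`
(three bases equally separated in a plane). -/
def triBasisState (j : Fin 3) (p : Bool) : Matrix (Fin 2) (Fin 2) ℂ :=
  (1 / 2 : ℝ) • ((1 : Matrix (Fin 2) (Fin 2) ℂ)
    + (sgn p * Real.sin (((j : ℕ) + 1) * Real.pi / 3)) • σx
    + (sgn p * Real.cos (((j : ℕ) + 1) * Real.pi / 3)) • σz)

/-- The Born rule for `triBasisState` in terms of matrix entries. -/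
theorem re_trace_triBasisState_mul (j : Fin 3) (p : Bool) (C : Matrix (Fin 2) (Fin 2) ℂ) :
    ((triBasisState j p * C).trace).re =
      ((C 0 0).re + (C 1 1).re
        + sgn p * (Real.sin (((j : ℕ) + 1) * Real.pi / 3) * ((C 0 1).re + (C 1 0).re)
          + Real.cos (((j : ℕ) + 1) * Real.pi / 3) * ((C 0 0).re - (C 1 1).re))) / 2 := by
  unfold triBasisState
  generalize Real.sin (((j : ℕ) + 1) * Real.pi / 3) = s
  generalize Real.cos (((j : ℕ) + 1) * Real.pi / 3) = c
  simp [Matrix.trace_fin_two, Matrix.mul_apply, Fin.sum_univ_two, σx, σz, -Complex.ofReal_sin,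
    -Complex.ofReal_cos]
  ring

theorem sin_two_pi_div_three : Real.sin (2 * Real.pi / 3) = √3 / 2 := by
  rw [show 2 * Real.pi / 3 = Real.pi - Real.pi / 3 by ring, Real.sin_pi_sub, Real.sin_pi_div_three]

theorem cos_two_pi_div_three : Real.cos (2 * Real.pi / 3) = -(1 / 2) := by
  rw [show 2 * Real.pi / 3 = Real.pi - Real.pi / 3 by ring, Real.cos_pi_sub, Real.cos_pi_div_three]

theorem sum_re_trace_triBasisState_mul (p : Fin 3 → Bool) (C : Matrix (Fin 2) (Fin 2) ℂ) :
    ∑ j, ((triBasisState j (p j) * C).trace).re =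
      (3 * ((C 0 0).re + (C 1 1).re)
        + √3 / 2 * (sgn (p 0) + sgn (p 1)) * ((C 0 1).re + (C 1 0).re)
        + (sgn (p 0) / 2 - sgn (p 1) / 2 - sgn (p 2)) * ((C 0 0).re - (C 1 1).re)) / 2 := by
  have h3 : (2 + 1 : ℝ) * Real.pi / 3 = Real.pi := by ring
  simp only [re_trace_triBasisState_mul, Fin.sum_univ_three, Fin.val_zero, Fin.val_one,
    Fin.val_two, Nat.cast_zero, Nat.cast_one, Nat.cast_ofNat, zero_add, one_mul, one_add_one_eq_two,
    h3, Real.sin_pi_div_three, Real.cos_pi_div_three, sin_two_pi_div_three, cos_two_pi_div_three,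
    Real.sin_pi, Real.cos_pi]
  ring

theorem sum_re_trace_triBasisState_mul_le (p : Fin 3 → Bool) {C : Matrix (Fin 2) (Fin 2) ℂ}
    (hC : C.PosSemidef) :
    ∑ j, ((triBasisState j (p j) * C).trace).re ≤ 5 / 2 * C.trace.re := by
  have ha : 0 ≤ (C 0 0).re := (Complex.le_def.1 hC.diag_nonneg).1
  have hd : 0 ≤ (C 1 1).re := (Complex.le_def.1 hC.diag_nonneg).1
  have hai : 0 = (C 0 0).im := (Complex.le_def.1 hC.diag_nonneg).2
  have hoff : C 1 0 = star (C 0 1) := (hC.isHermitian.apply 1 0).symm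
  have hdet : (C 0 1).re ^ 2 ≤ (C 0 0).re * (C 1 1).re := by
    have h := (Complex.le_def.1 hC.det_nonneg).1
    simp [Matrix.det_fin_two, hoff, ← hai] at h
    nlinarith [sq_nonneg (C 0 1).im]
  rw [sum_re_trace_triBasisState_mul, Matrix.trace_fin_two, hoff]
  generalize p 0 = p₀
  generalize p 1 = p₁
  generalize p 2 = p₂
  simp only [Complex.star_def, Complex.conj_re, Complex.add_re]
  generalize (C 0 0).re = a at *
  generalize (C 1 1).re = d at *
  generalize (C 0 1).re = r at *
  have key (u v : ℝ) (huv : u ^ 2 + v ^ 2 ≤ 4) : u * (r + r) + v * (a - d) ≤ 2 * (a + d) := by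
    refine le_of_abs_le <| abs_le_of_sq_le_sq ?_ (by positivity)
    nlinarith [sq_nonneg (u * (a - d) - v * (r + r)), mul_nonneg (sub_nonneg.2 huv)
      (add_nonneg (sq_nonneg (r + r)) (sq_nonneg (a - d)))]
  have hb : (√3 / 2 * (sgn p₀ + sgn p₁)) ^ 2 + (sgn p₀ / 2 - sgn p₁ / 2 - sgn p₂) ^ 2 ≤ 4 := by
    cases p₀ <;> cases p₁ <;> cases p₂ <;> norm_num [sgn]
  linarith [key _ _ hb]

theorem isHermitian_triBasisState (j : Fin 3) (p : Bool) : (triBasisState j p).IsHermitian := by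
  ext a b
  fin_cases a <;> fin_cases b <;> simp [triBasisState, σx, σz, -Complex.ofReal_sin,
    -Complex.ofReal_cos]

theorem triBasisState_mul_self (j : Fin 3) (p : Bool) :
    triBasisState j p * triBasisState j p = triBasisState j p := by
  have hsc := Real.sin_sq_add_cos_sq (((j : ℕ) + 1) * Real.pi / 3)
  have hp : sgn p ^ 2 = 1 := by cases p <;> simp [sgn]
  unfold triBasisState
  generalize Real.sin (((j : ℕ) + 1) * Real.pi / 3) = s at *
  generalize Real.cos (((j : ℕ) + 1) * Real.pi / 3) = c at *
  generalize sgn p = e at *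
  have h : (e : ℂ) ^ 2 * ((s : ℂ) ^ 2 + (c : ℂ) ^ 2) = 1 := by
    exact_mod_cast (by rw [hp, hsc, one_mul] : e ^ 2 * (s ^ 2 + c ^ 2) = 1)
  ext a b
  fin_cases a <;> fin_cases b <;>
    simp [Matrix.mul_apply, Fin.sum_univ_two, σx, σz] <;> grind

theorem posSemidef_triBasisState (j : Fin 3) (p : Bool) : (triBasisState j p).PosSemidef := by
  have h := Matrix.posSemidef_self_mul_conjTranspose (triBasisState j p)
  rwa [(isHermitian_triBasisState j p).eq, triBasisState_mul_self] at h

theorem trace_triBasisState (j : Fin 3) (p : Bool) : (triBasisState j p).trace = 1 := by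
  simp [triBasisState, Matrix.trace_fin_two, σx, σz]

theorem sum_triBasisState (j : Fin 3) : ∑ p, triBasisState j p = 1 := by
  ext a b
  fin_cases a <;> fin_cases b <;> simp [triBasisState, σx, σz, sgn] <;> ring

/-- The sign, in each basis, of the state closest to outcome `b` of the first basis. -/
def closestSigns (b : Bool) (i : Fin 3) : Bool := if i = 2 then !b else b

theorem sum_re_trace_closestSigns (b : Bool) :
    ∑ i, ((triBasisState i (closestSigns b i) * triBasisState 0 b).trace).re = 5 / 2 := by
  have h3 : √3 ^ 2 = 3 := Real.sq_sqrt (by norm_num)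
  rw [sum_re_trace_triBasisState_mul]
  cases b <;> simp [closestSigns, sgn, triBasisState, σx, σz] <;> grind

/-- For the six equally separated planar qubit states with uniform prior `1/6`
and basis partition `X_j = {(j,+),(j,-)}`, one has `P_meta = P_post = 5/6`:
(a) the optimum over POVMs `C` indexed by `{+1,-1}³` of
`(1/6) ∑_p ∑_j tr(ρ_{j,p_j} C p)` equals `5/6`; and
(b) the optimum over standard measurements `M_t(j,p) = t j • ρ_{j,p}` and relabeling maps
`f i : outcomes → X_i` of the post-processed success probability also equals `5/6`. -/
theorem meta_eq_post_three_planar_bases :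
    IsGreatest {P : ℝ | ∃ C : (Fin 3 → Bool) → Matrix (Fin 2) (Fin 2) ℂ,
        (∀ p, (C p).PosSemidef) ∧ (∑ p, C p = 1) ∧
        P = (1 / 6 : ℝ) * ∑ p : Fin 3 → Bool, ∑ j : Fin 3,
              ((triBasisState j (p j) * C p).trace).re}
      (5 / 6 : ℝ) ∧
    IsGreatest {P : ℝ | ∃ t : Fin 3 → ℝ, (∀ j, 0 ≤ t j) ∧ (∑ j, t j = 1) ∧
        ∃ f : Fin 3 → Fin 3 × Bool → Bool,
          P = ∑ i : Fin 3, ∑ j : Fin 3, ∑ p : Bool,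
            (1 / 6 : ℝ) *
              ((triBasisState i (f i (j, p)) * (t j • triBasisState j p)).trace).re}
      (5 / 6 : ℝ) := by
  refine ⟨⟨?_, ?_⟩, ?_, ?_⟩
  · refine ⟨fun p => ∑ b, if p = closestSigns b then triBasisState 0 b else 0, fun p => ?_, ?_, ?_⟩
    · refine Matrix.posSemidef_sum _ fun b _ => ?_
      split_ifs
      exacts [posSemidef_triBasisState 0 b, Matrix.PosSemidef.zero]
    · rw [Finset.sum_comm]
      simp only [Finset.sum_ite_eq', Finset.mem_univ, if_true, sum_triBasisState]
    · have h (p : Fin 3 → Bool) (j : Fin 3) :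
          ((triBasisState j (p j) *
            ∑ b, if p = closestSigns b then triBasisState 0 b else 0).trace).re =
          ∑ b, if p = closestSigns b then
            ((triBasisState j (closestSigns b j) * triBasisState 0 b).trace).re else 0 := by
        rw [Matrix.mul_sum, Matrix.trace_sum, Complex.re_sum]
        refine Finset.sum_congr rfl fun b _ => ?_
        split_ifs with hp <;> simp [hp]
      have h' : ∑ p : Fin 3 → Bool, ∑ j : Fin 3, ∑ b, (if p = closestSigns b then
            ((triBasisState j (closestSigns b j) * triBasisState 0 b).trace).re else 0) =
          ∑ b, ∑ j, ((triBasisState j (closestSigns b j) * triBasisState 0 b).trace).re := by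
        rw [Finset.sum_comm, Finset.sum_comm (s := Finset.univ (α := Bool))]
        refine Finset.sum_congr rfl fun j _ => ?_
        rw [Finset.sum_comm]
        simp only [Finset.sum_ite_eq', Finset.mem_univ, if_true]
      simp only [h, h', sum_re_trace_closestSigns]
      norm_num
  · rintro P ⟨C, hC, hsum, rfl⟩
    have htr : ∑ p, (C p).trace.re = 2 := by
      rw [← Complex.re_sum, ← Matrix.trace_sum, hsum]
      simp
    have h := Finset.sum_le_sum fun p (_ : p ∈ Finset.univ) =>
      sum_re_trace_triBasisState_mul_le p (hC p)
    rw [← Finset.mul_sum, htr] at h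
    linarith
  · refine ⟨Pi.single 0 1, fun j => ?_, by simp, fun i x => closestSigns x.2 i, ?_⟩
    · exact (Pi.single_nonneg.2 zero_le_one : (0 : Fin 3 → ℝ) ≤ Pi.single 0 1) j
    · have h := sum_re_trace_closestSigns true
      have h' := sum_re_trace_closestSigns false
      simp only [Fin.sum_univ_three] at h h'
      simp [Fin.sum_univ_three]
      linarith
  · rintro P ⟨t, ht, hsum, f, rfl⟩
    have h (j : Fin 3) (p : Bool) : ∑ i, (1 / 6 : ℝ) *
        ((triBasisState i (f i (j, p)) * (t j • triBasisState j p)).trace).re ≤ 5 / 12 * t j := by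
      have := sum_re_trace_triBasisState_mul_le (fun i => f i (j, p))
        ((posSemidef_triBasisState j p).smul (ht j))
      rw [Matrix.trace_smul, trace_triBasisState] at this
      rw [← Finset.mul_sum]
      simp only [Complex.smul_re, Complex.one_re, smul_eq_mul] at this
      linarith
    rw [Finset.sum_comm]
    calc _ ≤ ∑ j, ∑ _p : Bool, 5 / 12 * t j := by
          refine Finset.sum_le_sum fun j _ => ?_
          rw [Finset.sum_comm]
          exact Finset.sum_le_sum fun p _ => h j p
      _ = 5 / 6 := by
          simp only [Fintype.sum_bool, Finset.sum_add_distrib, ← Finset.mul_sum, hsum]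
          norm_num
end
end

section
/- Let 0 < θ < π and consider the four qubit states ρ_1 = ½(I + sin(θ/2)σx + cos(θ/2)σz), ρ_2 = ½(I − sin(θ/2)σx + cos(θ/2)σz), ρ_3 = ½(I + σx), ρ_4 = ½(I − σx), with uniform prior 1/4 and partition X_1 = {1,2}, X_2 = {3,4}. Then post-measurement side information is as good as pre-measurement side information: (a) the optimal pre-measurement value P_pre = ½·(optimal discrimination of {ρ_1,ρ_2} with equal priors) + ½·(optimal discrimination of {ρ_3,ρ_4} with equal priors) equals ¼(3 + sin(θ/2)); and (b) the projective measurement Π_± = ½(I ± σx), which is optimal for discriminating the four states without side information (achieving success probability ½), together with the relabeling f_1(+) = 1, f_1(−) = 2, f_2(+) = 3, f_2(−) = 4, achieves the post-processed success probability ∑_{ℓ=1}^2 ∑_{y∈{+,−}} (1/4) tr(ρ_{f_ℓ(y)} Π_y) = ¼(3 + sin(θ/2)). Hence P_pre = P_post. -/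
open Matrix
open scoped ComplexOrder

noncomputable section

/-- The four states `ρ_1 = ½(I + sin(θ/2)σx + cos(θ/2)σz)`,
`ρ_2 = ½(I - sin(θ/2)σx + cos(θ/2)σz)`, `ρ_3 = ½(I + σx)`, `ρ_4 = ½(I - σx)`,
indexed by `Fin 4` (so `0 ↦ ρ_1, …, 3 ↦ ρ_4`). -/
def fourState (θ : ℝ) : Fin 4 → Matrix (Fin 2) (Fin 2) ℂ
  | 0 => (1 / 2 : ℝ) • ((1 : Matrix (Fin 2) (Fin 2) ℂ)
      + Real.sin (θ / 2) • σx + Real.cos (θ / 2) • σz)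
  | 1 => (1 / 2 : ℝ) • ((1 : Matrix (Fin 2) (Fin 2) ℂ)
      + (-Real.sin (θ / 2)) • σx + Real.cos (θ / 2) • σz)
  | 2 => (1 / 2 : ℝ) • ((1 : Matrix (Fin 2) (Fin 2) ℂ) + (1 : ℝ) • σx)
  | 3 => (1 / 2 : ℝ) • ((1 : Matrix (Fin 2) (Fin 2) ℂ) + (-1 : ℝ) • σx)

/-- The projective measurement `Π_± = ½(I ± σx)`, indexed by `Bool` (`true ↦ +`). -/
def projX (y : Bool) : Matrix (Fin 2) (Fin 2) ℂ :=
  (1 / 2 : ℝ) • ((1 : Matrix (Fin 2) (Fin 2) ℂ) + sgn y • σx)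

/-- The real part of `tr (½(I + sσx + kσz) M)` in terms of the entries of `M`. -/
theorem re_trace_bloch_mul (s k : ℝ) (M : Matrix (Fin 2) (Fin 2) ℂ) :
    ((((1 / 2 : ℝ) • ((1 : Matrix (Fin 2) (Fin 2) ℂ) + s • σx + k • σz)) * M).trace).re
      = 1 / 2 * ((M 0 0).re + (M 1 1).re + s * ((M 0 1).re + (M 1 0).re)
        + k * ((M 0 0).re - (M 1 1).re)) := by
  simp [σx, σz, Matrix.trace, Matrix.mul_apply, Fin.sum_univ_two]
  ring

theorem re_trace_fourState_zero_mul (θ : ℝ) (M : Matrix (Fin 2) (Fin 2) ℂ) :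
    ((fourState θ 0 * M).trace).re
      = 1 / 2 * ((M 0 0).re + (M 1 1).re + Real.sin (θ / 2) * ((M 0 1).re + (M 1 0).re)
        + Real.cos (θ / 2) * ((M 0 0).re - (M 1 1).re)) :=
  re_trace_bloch_mul _ _ M

theorem re_trace_fourState_one_mul (θ : ℝ) (M : Matrix (Fin 2) (Fin 2) ℂ) :
    ((fourState θ 1 * M).trace).re
      = 1 / 2 * ((M 0 0).re + (M 1 1).re + -Real.sin (θ / 2) * ((M 0 1).re + (M 1 0).re)
        + Real.cos (θ / 2) * ((M 0 0).re - (M 1 1).re)) :=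
  re_trace_bloch_mul _ _ M

theorem re_trace_fourState_two_mul (θ : ℝ) (M : Matrix (Fin 2) (Fin 2) ℂ) :
    ((fourState θ 2 * M).trace).re
      = 1 / 2 * ((M 0 0).re + (M 1 1).re + ((M 0 1).re + (M 1 0).re)) := by
  simpa [fourState] using re_trace_bloch_mul 1 0 M

theorem re_trace_fourState_three_mul (θ : ℝ) (M : Matrix (Fin 2) (Fin 2) ℂ) :
    ((fourState θ 3 * M).trace).re
      = 1 / 2 * ((M 0 0).re + (M 1 1).re - ((M 0 1).re + (M 1 0).re)) := by
  simpa [fourState, sub_eq_add_neg] using re_trace_bloch_mul (-1) 0 M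

/-- The quadratic form of a positive semidefinite `2 × 2` matrix is nonnegative at real vectors. -/
theorem re_quadForm_nonneg {M : Matrix (Fin 2) (Fin 2) ℂ} (hM : M.PosSemidef) (x y : ℝ) :
    0 ≤ (M 0 0).re * x ^ 2 + ((M 0 1).re + (M 1 0).re) * (x * y) + (M 1 1).re * y ^ 2 := by
  have h := (Complex.le_def.1 (hM.dotProduct_mulVec_nonneg ![(x : ℂ), (y : ℂ)])).1
  simp [dotProduct, Matrix.mulVec, Fin.sum_univ_two] at h
  linarith

/-- A vector in the unit Bloch disc pairs with a positive semidefinite matrix to at most its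
trace. -/
theorem bloch_pairing_le {M : Matrix (Fin 2) (Fin 2) ℂ} (hM : M.PosSemidef) {s k : ℝ}
    (hsk : s ^ 2 + k ^ 2 ≤ 1) :
    s * ((M 0 1).re + (M 1 0).re) + k * ((M 0 0).re - (M 1 1).re)
      ≤ (M 0 0).re + (M 1 1).re := by
  have ha : 0 ≤ (M 0 0).re := by simpa using re_quadForm_nonneg hM 1 0
  have hd : 0 ≤ (M 1 1).re := by simpa using re_quadForm_nonneg hM 0 1
  have hq := discrim_le_zero fun x => by
    have h := re_quadForm_nonneg hM x 1
    simpa [sq, mul_assoc] using h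
  unfold discrim at hq
  generalize (M 0 0).re = a at *
  generalize (M 1 1).re = d at *
  generalize (M 0 1).re + (M 1 0).re = t at *
  refine le_of_sq_le_sq ?_ (by positivity)
  calc (s * t + k * (a - d)) ^ 2
      ≤ (s ^ 2 + k ^ 2) * (t ^ 2 + (a - d) ^ 2) := by nlinarith [sq_nonneg (s * (a - d) - k * t)]
    _ ≤ 1 * (t ^ 2 + (a - d) ^ 2) := by gcongr
    _ ≤ (a + d) ^ 2 := by linarith

theorem projX_posSemidef (y : Bool) : (projX y).PosSemidef := by
  have h : projX y = (projX y)ᴴ * projX y := by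
    cases y <;> ext i j <;> fin_cases i <;> fin_cases j <;>
      simp [projX, σx, sgn, Matrix.mul_apply, Fin.sum_univ_two, Complex.conj_ofNat] <;> norm_num
  rw [h]
  exact Matrix.posSemidef_conjTranspose_mul_self _

theorem projX_true_add_projX_false : projX true + projX false = 1 := by
  ext i j
  fin_cases i <;> fin_cases j <;> simp [projX, σx, sgn] <;> norm_num

/-- For `0 < θ < π`, uniform prior `1/4` and partition
`X_1 = {ρ_1, ρ_2}`, `X_2 = {ρ_3, ρ_4}`:
(a) `P_pre`, i.e. half of the optimal equal-prior discrimination of `{ρ_1,ρ_2}` plus half of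
that of `{ρ_3,ρ_4}`, equals `¼(3 + sin(θ/2))`;
(b) the measurement `Π_± = ½(I ± σx)` is optimal for discriminating the four states without
side information (the no-side-information optimum is `½` and `Π` attains it, guessing `ρ_3`
on `+` and `ρ_4` on `-`), and together with the relabeling `f_1(+) = ρ_1`, `f_1(-) = ρ_2`,
`f_2(+) = ρ_3`, `f_2(-) = ρ_4` it achieves the post-processed success probability
`¼(3 + sin(θ/2))`. Hence `P_pre = P_post`. -/
theorem pre_eq_post_two_plus_orthogonal
    (θ : ℝ) (h0 : 0 < θ) (hπ : θ < Real.pi) :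
    (∃ P1 P2 : ℝ,
      IsGreatest {P : ℝ | ∃ M : Fin 2 → Matrix (Fin 2) (Fin 2) ℂ,
          (∀ i, (M i).PosSemidef) ∧ (∑ i, M i = 1) ∧
          P = (1 / 2 : ℝ) * ((fourState θ 0 * M 0).trace).re
            + (1 / 2 : ℝ) * ((fourState θ 1 * M 1).trace).re} P1 ∧
      IsGreatest {P : ℝ | ∃ M : Fin 2 → Matrix (Fin 2) (Fin 2) ℂ,
          (∀ i, (M i).PosSemidef) ∧ (∑ i, M i = 1) ∧
          P = (1 / 2 : ℝ) * ((fourState θ 2 * M 0).trace).re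
            + (1 / 2 : ℝ) * ((fourState θ 3 * M 1).trace).re} P2 ∧
      (1 / 2 : ℝ) * P1 + (1 / 2 : ℝ) * P2 = (1 / 4 : ℝ) * (3 + Real.sin (θ / 2))) ∧
    IsGreatest {P : ℝ | ∃ M : Fin 4 → Matrix (Fin 2) (Fin 2) ℂ,
        (∀ x, (M x).PosSemidef) ∧ (∑ x, M x = 1) ∧
        P = (1 / 4 : ℝ) * ∑ x : Fin 4, ((fourState θ x * M x).trace).re}
      (1 / 2 : ℝ) ∧
    (1 / 4 : ℝ) * (((fourState θ 2 * projX true).trace).re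
      + ((fourState θ 3 * projX false).trace).re) = 1 / 2 ∧
    (1 / 4 : ℝ) * (((fourState θ 0 * projX true).trace).re
      + ((fourState θ 1 * projX false).trace).re
      + ((fourState θ 2 * projX true).trace).re
      + ((fourState θ 3 * projX false).trace).re)
      = (1 / 4 : ℝ) * (3 + Real.sin (θ / 2)) := by
  have hsum : ∀ {n : ℕ} {M : Fin n → Matrix (Fin 2) (Fin 2) ℂ}, ∑ x, M x = 1 →
      ∑ x, (M x 0 0).re = 1 ∧ ∑ x, (M x 1 1).re = 1 := fun {n M} h => by
    constructor
    · simpa [Matrix.sum_apply] using congrArg (fun A => (A 0 0).re) h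
    · simpa [Matrix.sum_apply] using congrArg (fun A => (A 1 1).re) h
  have hs : 0 ≤ Real.sin (θ / 2) :=
    Real.sin_nonneg_of_nonneg_of_le_pi (by linarith) (by linarith)
  have hx : ∀ {M : Matrix (Fin 2) (Fin 2) ℂ}, M.PosSemidef →
      (M 0 1).re + (M 1 0).re ≤ (M 0 0).re + (M 1 1).re := fun hM => by
    simpa using bloch_pairing_le hM (s := 1) (k := 0) (by norm_num)
  have hx' : ∀ {M : Matrix (Fin 2) (Fin 2) ℂ}, M.PosSemidef →
      -((M 0 1).re + (M 1 0).re) ≤ (M 0 0).re + (M 1 1).re := fun hM => by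
    simpa [add_comm] using bloch_pairing_le hM (s := -1) (k := 0) (by norm_num)
  have hp : ∀ i, (![projX true, projX false] i).PosSemidef := by
    intro i
    fin_cases i <;> exact projX_posSemidef _
  have hp1 : ∑ i, ![projX true, projX false] i = 1 := by
    simpa using projX_true_add_projX_false
  refine ⟨⟨1 / 2 * (1 + Real.sin (θ / 2)), 1, ⟨⟨_, hp, hp1, ?_⟩, ?_⟩, ⟨⟨_, hp, hp1, ?_⟩, ?_⟩,
    by ring⟩, ⟨⟨![0, 0, projX true, projX false], ?_, ?_, ?_⟩, ?_⟩, ?_, ?_⟩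
  · simp [re_trace_fourState_zero_mul, re_trace_fourState_one_mul, projX, σx, sgn]
    ring
  · rintro P ⟨M, hM, h1, rfl⟩
    obtain ⟨ha, hd⟩ := hsum h1
    rw [Fin.sum_univ_two] at ha hd
    rw [re_trace_fourState_zero_mul, re_trace_fourState_one_mul]
    have h : ((M 0 0 1).re + (M 0 1 0).re) - ((M 1 0 1).re + (M 1 1 0).re) ≤ 2 := by
      linarith [hx (hM 0), hx' (hM 1)]
    linear_combination (1 / 4 : ℝ) * mul_le_mul_of_nonneg_left h hs
      + (1 / 4 + Real.cos (θ / 2) / 4) * ha + (1 / 4 - Real.cos (θ / 2) / 4) * hd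
  · simp [re_trace_fourState_two_mul, re_trace_fourState_three_mul, projX, σx, sgn]
    norm_num
  · rintro P ⟨M, hM, h1, rfl⟩
    obtain ⟨ha, hd⟩ := hsum h1
    rw [Fin.sum_univ_two] at ha hd
    rw [re_trace_fourState_two_mul, re_trace_fourState_three_mul]
    linarith [hx (hM 0), hx' (hM 1)]
  · intro i
    fin_cases i
    exacts [.zero, .zero, projX_posSemidef _, projX_posSemidef _]
  · simpa [Fin.sum_univ_four] using projX_true_add_projX_false
  · simp [Fin.sum_univ_four, re_trace_fourState_two_mul, re_trace_fourState_three_mul, projX, σx,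
      sgn]
    norm_num
  · rintro P ⟨M, hM, h1, rfl⟩
    obtain ⟨ha, hd⟩ := hsum h1
    rw [Fin.sum_univ_four] at ha hd ⊢
    rw [re_trace_fourState_zero_mul, re_trace_fourState_one_mul, re_trace_fourState_two_mul,
      re_trace_fourState_three_mul]
    have hsc := Real.sin_sq_add_cos_sq (θ / 2)
    linarith [bloch_pairing_le (hM 0) hsc.le,
      bloch_pairing_le (hM 1) (s := -Real.sin (θ / 2)) (k := Real.cos (θ / 2))
        (by rw [neg_sq]; exact hsc.le),
      hx (hM 2), hx' (hM 3)]
  · simp [re_trace_fourState_two_mul, re_trace_fourState_three_mul, projX, σx, sgn]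
    norm_num
  · simp [re_trace_fourState_zero_mul, re_trace_fourState_one_mul, re_trace_fourState_two_mul,
      re_trace_fourState_three_mul, projX, σx, sgn]
    ring
end
end

section
/- Let X be a finite symbol set with prior probabilities q_x > 0 summing to 1, let ρ_x be density matrices on ℂ^d, and let X = ∪_ℓ X_ℓ be a partition. Set q_ℓ = ∑_{x∈X_ℓ} q_x and ρ_ℓ = (1/q_ℓ) ∑_{x∈X_ℓ} q_x ρ_x, and assume each ρ_ℓ is positive definite. For x ∈ X_ℓ define the pre-measurement maximum confidence C_pre(x) = sup { q_x tr(ρ_x E) / (q_ℓ tr(ρ_ℓ E)) : 0 ≤ E ≤ I, tr(ρ_ℓ E) > 0 }. Then there exists a single family of positive semidefinite matrices (N(x))_{x∈X} with ∑_{x∈X} N(x) ≤ I such that for every x ∈ X (with ℓ the part containing x): tr(ρ_ℓ N(x)) > 0 and q_x tr(ρ_x N(x)) / (q_ℓ tr(ρ_ℓ N(x))) = C_pre(x). In particular, post-measurement side information with metainformation achieves the same maximum confidence as pre-measurement side information: C_meta(x) = C_pre(x) for all x. -/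
open Matrix
open scoped ComplexOrder

open scoped MatrixOrder in
/-- The trace of a product of two positive semidefinite matrices has nonnegative real part. -/
theorem Matrix.PosSemidef.re_trace_mul_nonneg_s16 {n : Type*} [Fintype n] {A B : Matrix n n ℂ}
    (hA : A.PosSemidef) (hB : B.PosSemidef) : 0 ≤ ((A * B).trace).re := by
  classical
  obtain ⟨C, rfl⟩ := CStarAlgebra.nonneg_iff_eq_star_mul_self.mp hB.nonneg
  have h := (hA.mul_mul_conjTranspose_same C).trace_nonneg
  rw [← star_eq_conjTranspose, mul_assoc, trace_mul_comm, mul_assoc] at h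
  exact (Complex.le_def.mp h).1

/-- A rank-one matrix `v vᴴ` with `v` a unit vector is bounded above by the identity. -/
theorem Matrix.posSemidef_one_sub_vecMulVec_self_star {n : Type*} [Fintype n] [DecidableEq n]
    {v : n → ℂ} (hv : star v ⬝ᵥ v = 1) :
    ((1 : Matrix n n ℂ) - vecMulVec v (star v)).PosSemidef := by
  have hP : (vecMulVec v (star v))ᴴ = vecMulVec v (star v) :=
    (posSemidef_vecMulVec_self_star v).isHermitian
  have hPP : vecMulVec v (star v) * vecMulVec v (star v) = vecMulVec v (star v) := by
    rw [vecMulVec_mul_vecMulVec, hv, one_smul]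
  have h := posSemidef_conjTranspose_mul_self ((1 : Matrix n n ℂ) - vecMulVec v (star v))
  rwa [conjTranspose_sub, conjTranspose_one, hP, sub_mul, mul_sub, mul_sub, hPP, one_mul,
    mul_one, one_mul, sub_self, sub_zero] at h

theorem Matrix.re_trace_mul_vecMulVec_self_star {n : Type*} [Fintype n] (A : Matrix n n ℂ)
    (v : n → ℂ) : ((A * vecMulVec v (star v)).trace).re = (star v ⬝ᵥ A *ᵥ v).re := by
  rw [mul_vecMulVec, trace_vecMulVec, dotProduct_comm]

/-- The generalized Rayleigh quotient of a Hermitian matrix `A` with respect to a positive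
definite matrix `R` attains its maximum `c` at some unit vector. -/
theorem Matrix.IsHermitian.exists_unit_max_rayleigh {n : Type*} [Fintype n] [Nonempty n]
    {A R : Matrix n n ℂ} (hA : A.IsHermitian) (hR : R.PosDef) :
    ∃ (v : n → ℂ) (c : ℝ), star v ⬝ᵥ v = 1 ∧ 0 < (star v ⬝ᵥ R *ᵥ v).re ∧
      (star v ⬝ᵥ A *ᵥ v).re = c * (star v ⬝ᵥ R *ᵥ v).re ∧ (c • R - A).PosSemidef := by
  let f (M : Matrix n n ℂ) (x : EuclideanSpace ℂ n) : ℝ := (star x.ofLp ⬝ᵥ M *ᵥ x.ofLp).re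
  have hf (M : Matrix n n ℂ) : Continuous (f M) := by
    unfold f
    fun_prop
  have hpos (x : EuclideanSpace ℂ n) (hx : x ≠ 0) : 0 < f R x := by
    have hx' : x.ofLp ≠ 0 := by simpa using hx
    exact (Complex.lt_def.mp (hR.dotProduct_mulVec_pos hx')).1
  have hhom (M : Matrix n n ℂ) (r : ℝ) (x : EuclideanSpace ℂ n) :
      f M ((r : ℂ) • x) = r * (r * f M x) := by
    simp [f, mulVec_smul]
  have hne {x : EuclideanSpace ℂ n} (hx : x ∈ Metric.sphere 0 1) : x ≠ 0 := by
    rintro rfl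
    simp at hx
  obtain ⟨u, hu, hmax⟩ := (isCompact_sphere (0 : EuclideanSpace ℂ n) 1).exists_isMaxOn
    (NormedSpace.sphere_nonempty.mpr zero_le_one)
    (f := fun x => f A x / f R x)
    ((hf A).continuousOn.div (hf R).continuousOn fun x hx => (hpos x (hne hx)).ne')
  have hRu := hpos u (hne hu)
  refine ⟨u.ofLp, f A u / f R u, ?_, hRu, (div_mul_cancel₀ _ hRu.ne').symm, ?_⟩
  · have h : inner ℂ u u = (1 : ℂ) := by
      rw [inner_self_eq_norm_sq_to_K, mem_sphere_zero_iff_norm.mp hu]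
      simp
    rwa [EuclideanSpace.inner_eq_star_dotProduct, dotProduct_comm] at h
  set c := f A u / f R u with hc
  have hH : (c • R - A).IsHermitian :=
    IsHermitian.sub (IsSelfAdjoint.smul (.all c) hR.isHermitian) hA
  refine .of_dotProduct_mulVec_nonneg hH fun w => ?_
  rw [Complex.le_def]
  refine ⟨?_, (hH.im_star_dotProduct_mulVec_self w).symm⟩
  rcases eq_or_ne w 0 with rfl | hw
  · simp
  let x : EuclideanSpace ℂ n := WithLp.toLp 2 w
  have hx : x ≠ 0 := by simpa [x] using hw
  have hxn : ‖x‖ ≠ 0 := norm_ne_zero_iff.mpr hx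
  have hmem : (((‖x‖⁻¹ : ℝ) : ℂ) • x) ∈ Metric.sphere (0 : EuclideanSpace ℂ n) 1 := by
    simp [norm_smul, hxn]
  have h : f A (((‖x‖⁻¹ : ℝ) : ℂ) • x) / f R (((‖x‖⁻¹ : ℝ) : ℂ) • x) ≤ c := hmax hmem
  have hxi : ‖x‖⁻¹ ≠ 0 := inv_ne_zero hxn
  rw [hhom, hhom, mul_div_mul_left _ _ hxi, mul_div_mul_left _ _ hxi,
    div_le_iff₀ (hpos x hx)] at h
  have hw' : (star w ⬝ᵥ (c • R - A) *ᵥ w).re = c * f R x - f A x := by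
    simp [f, x, sub_mulVec, smul_mulVec]
  rw [hw']
  simpa using h

/-- Section 4.3 of the paper: with metainformation about the partition
(given by the part-labelling map `π : X → L`), there is a single sub-POVM `N` (the anticipative
maximum-confidence measurement) that simultaneously attains, for every symbol `x`, the maximum
confidence `C_pre x` achievable with pre-measurement side information; hence
`C_meta x = C_pre x` for all `x`. -/
theorem anticipative_mcm_attains_pre_confidence
    (d : ℕ) (X L : Type) [Fintype X] [Fintype L] [DecidableEq L]
    (q : X → ℝ) (hq : ∀ x, 0 < q x) (hq1 : ∑ x, q x = 1)
    (ρ : X → Matrix (Fin d) (Fin d) ℂ)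
    (hρ : ∀ x, (ρ x).PosSemidef) (htr : ∀ x, (ρ x).trace = 1)
    (π : X → L) (hπ : Function.Surjective π)
    (qL : L → ℝ)
    (hqL : ∀ l, qL l = ∑ x ∈ Finset.univ.filter (fun x => π x = l), q x)
    (ρL : L → Matrix (Fin d) (Fin d) ℂ)
    (hρL : ∀ l, ρL l = (qL l)⁻¹ • ∑ x ∈ Finset.univ.filter (fun x => π x = l), q x • ρ x)
    (hpd : ∀ l, (ρL l).PosDef)
    (Cpre : X → ℝ)
    (hCpre : ∀ x, Cpre x = sSup {c : ℝ | ∃ E : Matrix (Fin d) (Fin d) ℂ,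
        E.PosSemidef ∧ ((1 : Matrix (Fin d) (Fin d) ℂ) - E).PosSemidef ∧
        0 < ((ρL (π x) * E).trace).re ∧
        c = (q x * ((ρ x * E).trace).re) / (qL (π x) * ((ρL (π x) * E).trace).re)}) :
    ∃ N : X → Matrix (Fin d) (Fin d) ℂ,
      (∀ x, (N x).PosSemidef) ∧
      ((1 : Matrix (Fin d) (Fin d) ℂ) - ∑ x, N x).PosSemidef ∧
      ∀ x, 0 < ((ρL (π x) * N x).trace).re ∧
        (q x * ((ρ x * N x).trace).re) / (qL (π x) * ((ρL (π x) * N x).trace).re) = Cpre x := by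
  classical
  have hX : Nonempty X := by
    by_contra h
    rw [not_nonempty_iff] at h
    simp at hq1
  have hd : Nonempty (Fin d) := by
    by_contra h
    rw [not_nonempty_iff] at h
    obtain ⟨x⟩ := hX
    simpa [Matrix.trace] using htr x
  have hqLpos (x : X) : 0 < qL (π x) := by
    rw [hqL]
    exact Finset.sum_pos (fun y _ => hq y) ⟨x, by simp⟩
  choose v c hv hvpos hvc hmax using fun x =>
    (hρ x).isHermitian.exists_unit_max_rayleigh (hpd (π x))
  let P (x : X) : Matrix (Fin d) (Fin d) ℂ := vecMulVec (v x) (star (v x))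
  have hP (x : X) : (P x).PosSemidef := posSemidef_vecMulVec_self_star _
  have hP1 (x : X) : (1 - P x).PosSemidef := posSemidef_one_sub_vecMulVec_self_star (hv x)
  have hPpos (x : X) : 0 < ((ρL (π x) * P x).trace).re := by
    rw [re_trace_mul_vecMulVec_self_star]
    exact hvpos x
  have hPc (x : X) : ((ρ x * P x).trace).re = c x * ((ρL (π x) * P x).trace).re := by
    rw [re_trace_mul_vecMulVec_self_star, re_trace_mul_vecMulVec_self_star]
    exact hvc x
  have hval (x : X) :
      (q x * ((ρ x * P x).trace).re) / (qL (π x) * ((ρL (π x) * P x).trace).re) = Cpre x := by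
    rw [hCpre]
    symm
    apply IsGreatest.csSup_eq
    refine ⟨⟨P x, hP x, hP1 x, hPpos x, rfl⟩, ?_⟩
    rintro _ ⟨E, hE, -, hEpos, rfl⟩
    have h := (hmax x).re_trace_mul_nonneg_s16 hE
    rw [sub_mul, smul_mul_assoc, trace_sub, trace_smul, Complex.sub_re, Complex.smul_re,
      smul_eq_mul, sub_nonneg] at h
    rw [mul_div_mul_comm, mul_div_mul_comm, hPc, mul_div_cancel_right₀ _ (hPpos x).ne']
    exact mul_le_mul_of_nonneg_left ((div_le_iff₀ hEpos).mpr h)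
      (div_pos (hq x) (hqLpos x)).le
  have hcard : (0 : ℝ) < Fintype.card X := by exact_mod_cast Fintype.card_pos
  have hs : 0 < (Fintype.card X : ℝ)⁻¹ := inv_pos.mpr hcard
  refine ⟨fun x => (Fintype.card X : ℝ)⁻¹ • P x, fun x => (hP x).smul hs.le, ?_, fun x => ?_⟩
  · have h : (1 : Matrix (Fin d) (Fin d) ℂ) - ∑ x, (Fintype.card X : ℝ)⁻¹ • P x =
        ∑ x, (Fintype.card X : ℝ)⁻¹ • (1 - P x) := by
      simp only [smul_sub, Finset.sum_sub_distrib, Finset.sum_const, Finset.card_univ]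
      rw [← Nat.cast_smul_eq_nsmul ℝ, smul_smul, mul_inv_cancel₀ hcard.ne', one_smul]
    rw [h]
    exact posSemidef_sum _ fun x _ => (hP1 x).smul hs.le
  · have htrace (M : Matrix (Fin d) (Fin d) ℂ) :
        ((M * (Fintype.card X : ℝ)⁻¹ • P x).trace).re =
          (Fintype.card X : ℝ)⁻¹ * ((M * P x).trace).re := by
      rw [mul_smul_comm, trace_smul, Complex.smul_re, smul_eq_mul]
    rw [htrace, htrace]
    refine ⟨mul_pos hs (hPpos x), ?_⟩
    rw [mul_left_comm, mul_left_comm (qL (π x)), mul_div_mul_left _ _ hs.ne']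
    exact hval x
end

section
/- Consider the tetrahedron ensemble of four pure qubit states ρ_x = |ψ_x⟩⟨ψ_x| with |ψ_{1+}⟩ = |0⟩, |ψ_{1−}⟩ = (1/√3)|0⟩ + √(2/3)|1⟩, |ψ_{2±}⟩ = (1/√3)|0⟩ + e^{±2πi/3}√(2/3)|1⟩, uniform prior 1/4, partitioned into X_1 = {1+,1−}, X_2 = {2+,2−}, with part states ρ_ℓ = ½(ρ_{ℓ+} + ρ_{ℓ−}). For the maximum-confidence measurement N(y) = ½ ρ_y (a POVM), the maximum confidence with post-measurement side information is ¾ for every symbol: for each x ∈ X_ℓ, max over outcomes y of (¼ tr(ρ_x N(y))) / (½ tr(ρ_ℓ N(y))) = ¾, and the maximum is attained at y = x. -/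
open Matrix
open scoped ComplexOrder

noncomputable section

/-- The unit vectors of the tetrahedron ensemble: `ψ_{1+} = |0⟩`,
`ψ_{1-} = (1/√3)|0⟩ + √(2/3)|1⟩`, `ψ_{2±} = (1/√3)|0⟩ + e^{±2πi/3}√(2/3)|1⟩`. -/
def tetraVec (l : Fin 2) (p : Bool) : Fin 2 → ℂ :=
  if l = 0 then
    (if p then ![1, 0] else ![((1 / Real.sqrt 3 : ℝ) : ℂ), ((Real.sqrt (2 / 3) : ℝ) : ℂ)])
  else
    ![((1 / Real.sqrt 3 : ℝ) : ℂ),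
      Complex.exp (((sgn p * (2 * Real.pi / 3) : ℝ) : ℂ) * Complex.I) *
        ((Real.sqrt (2 / 3) : ℝ) : ℂ)]

/-- The tetrahedron states `ρ_x = |ψ_x⟩⟨ψ_x|`. -/
def tetraState (l : Fin 2) (p : Bool) : Matrix (Fin 2) (Fin 2) ℂ :=
  Matrix.vecMulVec (tetraVec l p) (fun i => star (tetraVec l p i))

/-- The average state of each part, `ρ_ℓ = ½(ρ_{ℓ+} + ρ_{ℓ-})`. -/
def tetraPart (l : Fin 2) : Matrix (Fin 2) (Fin 2) ℂ :=
  (1 / 2 : ℝ) • (tetraState l true + tetraState l false)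

/-- The maximum-confidence measurement `N(y) = ½ ρ_y`. -/
def tetraMcm (y : Fin 2 × Bool) : Matrix (Fin 2) (Fin 2) ℂ :=
  (1 / 2 : ℝ) • tetraState y.1 y.2

/-- The confidence for symbol `x = (l,p)` given outcome `y` and side information `l`:
`q_x tr(ρ_x N(y)) / (q_ℓ tr(ρ_ℓ N(y)))` with `q_x = ¼`, `q_ℓ = ½`. -/
def tetraConf (l : Fin 2) (p : Bool) (y : Fin 2 × Bool) : ℝ :=
  ((1 / 4 : ℝ) * ((tetraState l p * tetraMcm y).trace).re) /
    ((1 / 2 : ℝ) * ((tetraPart l * tetraMcm y).trace).re)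

theorem Complex.exp_sgn_mul_two_pi_div_three (p : Bool) :
    Complex.exp (((sgn p * (2 * Real.pi / 3) : ℝ) : ℂ) * Complex.I) =
      ⟨-(1 / 2), sgn p * (Real.sqrt 3 / 2)⟩ := by
  have hcos : Real.cos (2 * Real.pi / 3) = -(1 / 2) := by
    rw [show 2 * Real.pi / 3 = Real.pi - Real.pi / 3 by ring, Real.cos_pi_sub,
      Real.cos_pi_div_three]
  have hsin : Real.sin (2 * Real.pi / 3) = Real.sqrt 3 / 2 := by
    rw [show 2 * Real.pi / 3 = Real.pi - Real.pi / 3 by ring, Real.sin_pi_sub,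
      Real.sin_pi_div_three]
  apply Complex.ext
  · rw [Complex.exp_ofReal_mul_I_re]
    cases p <;> simp [sgn, hcos]
  · rw [Complex.exp_ofReal_mul_I_im]
    cases p <;> simp [sgn, hsin]

theorem one_div_sqrt_three_mul_sqrt_two_thirds :
    1 / Real.sqrt 3 * Real.sqrt (2 / 3) = Real.sqrt 2 / 3 := by
  have h3 : Real.sqrt 3 ^ 2 = 3 := Real.sq_sqrt (by norm_num)
  rw [Real.sqrt_div (by norm_num)]
  field_simp
  linarith

theorem tetraState_zero_true : tetraState 0 true = !![1, 0; 0, 0] := by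
  ext i j
  fin_cases i <;> fin_cases j <;> simp [tetraState, tetraVec, vecMulVec_apply]

theorem tetraState_zero_false :
    tetraState 0 false =
      !![⟨1 / 3, 0⟩, ⟨Real.sqrt 2 / 3, 0⟩; ⟨Real.sqrt 2 / 3, 0⟩, ⟨2 / 3, 0⟩] := by
  have h₁ : 1 / Real.sqrt 3 * (1 / Real.sqrt 3) = 1 / 3 := by
    rw [div_mul_div_comm, Real.mul_self_sqrt (by norm_num), one_mul]
  have h₂ : Real.sqrt (2 / 3) * Real.sqrt (2 / 3) = 2 / 3 :=
    Real.mul_self_sqrt (by norm_num)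
  have h₃ := one_div_sqrt_three_mul_sqrt_two_thirds
  set a := 1 / Real.sqrt 3 with ha
  set b := Real.sqrt (2 / 3) with hb
  ext i j
  fin_cases i <;> fin_cases j <;> apply Complex.ext <;>
    simp [tetraState, tetraVec, vecMulVec_apply, ← ha, ← hb, -one_div] <;> linarith

theorem tetraState_one (p : Bool) :
    tetraState 1 p =
      !![⟨1 / 3, 0⟩, ⟨-(Real.sqrt 2 / 6), -(sgn p * Real.sqrt 2 * Real.sqrt 3 / 6)⟩;
        ⟨-(Real.sqrt 2 / 6), sgn p * Real.sqrt 2 * Real.sqrt 3 / 6⟩, ⟨2 / 3, 0⟩] := by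
  have h₁ : 1 / Real.sqrt 3 * (1 / Real.sqrt 3) = 1 / 3 := by
    rw [div_mul_div_comm, Real.mul_self_sqrt (by norm_num), one_mul]
  have h₂ : Real.sqrt (2 / 3) * Real.sqrt (2 / 3) = 2 / 3 :=
    Real.mul_self_sqrt (by norm_num)
  have h₃ := one_div_sqrt_three_mul_sqrt_two_thirds
  have h₄ : Real.sqrt 3 * Real.sqrt 3 = 3 := Real.mul_self_sqrt (by norm_num)
  have hs : sgn p * sgn p = 1 := by cases p <;> simp [sgn]
  unfold tetraState tetraVec
  rw [Complex.exp_sgn_mul_two_pi_div_three]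
  generalize 1 / Real.sqrt 3 = a at *
  generalize Real.sqrt (2 / 3) = b at *
  ext i j
  fin_cases i <;> fin_cases j <;> apply Complex.ext <;> simp [vecMulVec_apply] <;> grind

/-- Distinct tetrahedron states have overlap `1/3`. -/
theorem re_trace_tetraState_mul (l m : Fin 2) (p q : Bool) :
    ((tetraState l p * tetraState m q).trace).re = if (l, p) = (m, q) then 1 else 1 / 3 := by
  have h₂ : Real.sqrt 2 * Real.sqrt 2 = 2 := Real.mul_self_sqrt (by norm_num)
  have h₃ : Real.sqrt 3 * Real.sqrt 3 = 3 := Real.mul_self_sqrt (by norm_num)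
  fin_cases l <;> fin_cases m <;> cases p <;> cases q <;>
    simp [tetraState_zero_true, tetraState_zero_false, tetraState_one, trace_fin_two,
      sgn] <;> grind

theorem sum_tetraMcm : ∑ y : Fin 2 × Bool, tetraMcm y = 1 := by
  rw [Fintype.sum_prod_type]
  simp only [Fin.sum_univ_two, Fintype.sum_bool, tetraMcm, tetraState_zero_true,
    tetraState_zero_false, tetraState_one]
  ext i j
  fin_cases i <;> fin_cases j <;> apply Complex.ext <;> simp [sgn] <;> ring

/-- With uniform priors the confidence is the overlap with `ρ_x` relative to the total overlap
with the states of its part. -/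
theorem tetraConf_eq (l : Fin 2) (p : Bool) (y : Fin 2 × Bool) :
    tetraConf l p y = (if (l, p) = y then 1 else 1 / 3) /
      ((if (l, true) = y then 1 else 1 / 3) + (if (l, false) = y then 1 else 1 / 3)) := by
  obtain ⟨m, q⟩ := y
  simp only [tetraConf, tetraPart, tetraMcm, Matrix.smul_mul, Matrix.mul_smul, Matrix.add_mul,
    trace_smul, trace_add, Complex.smul_re, Complex.add_re, re_trace_tetraState_mul, smul_eq_mul]
  field_simp
  ring

theorem tetraConf_self (l : Fin 2) (p : Bool) : tetraConf l p (l, p) = 3 / 4 := by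
  rw [tetraConf_eq]
  cases p <;> norm_num

theorem tetraConf_le (l : Fin 2) (p : Bool) (y : Fin 2 × Bool) : tetraConf l p y ≤ 3 / 4 := by
  rw [tetraConf_eq]
  obtain ⟨m, q⟩ := y
  by_cases h : l = m <;> cases p <;> cases q <;> norm_num [h]

/-- For the tetrahedron ensemble with uniform prior `1/4` and partition
`X_ℓ = {(ℓ,+),(ℓ,-)}`, the measurement `N(y) = ½ ρ_y` is a POVM and the maximum confidence
with post-measurement side information is `¾` for every symbol: for each `x = (l,p)` the
maximum over outcomes `y` of the confidence is `¾`, attained at `y = x`. -/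
theorem tetrahedron_post_confidence :
    (∑ y : Fin 2 × Bool, tetraMcm y = 1) ∧
    ∀ (l : Fin 2) (p : Bool),
      IsGreatest {c : ℝ | ∃ y : Fin 2 × Bool, c = tetraConf l p y} (3 / 4 : ℝ) ∧
      tetraConf l p (l, p) = 3 / 4 := by
  exact ⟨sum_tetraMcm, fun l p => ⟨⟨⟨(l, p), (tetraConf_self l p).symm⟩, by
    rintro _ ⟨y, rfl⟩
    exact tetraConf_le l p y⟩, tetraConf_self l p⟩⟩
end
end
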